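/- arXiv:2412.19728 — 5 statements merged into one kernel-verified Lean document; each statement's English description precedes it below -/
import Mathlib

section
/- Let ν ≥ 2 and let P(X) = c_ν X^ν + ⋯ + c_1 X ∈ ℤ[X] have nonzero discriminant. For each positive integer Q, let B_Q be a subset of the primes not exceeding Q, with #B_Q → ∞ as Q → ∞, and let N_Q = #M_{B_Q,P}. Then the limiting pair correlation of (M_{B_Q,P})_{Q≥1} exists and is Poissonian — that is, for every Λ > 0, lim_{Q→∞} S_{M_{B_Q,P}}(Λ) = Λ — if and only if Σ_{p ∈ B_Q} p² = o(N_Q²) as Q → ∞. -/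
open Finset Filter

/-- The pairs `(a, q)` with `1 ≤ a ≤ q ≤ Q` and `gcd (P(a), q) = 1`, indexing the
polynomial Farey fractions `a / q` of order `Q`. -/
def fareyPairs (P : Polynomial ℤ) (Q : ℕ) : Finset (ℕ × ℕ) :=
  (Finset.Icc 1 Q ×ˢ Finset.Icc 1 Q).filter
    (fun x => x.1 ≤ x.2 ∧ Int.gcd (P.eval (x.1 : ℤ)) (x.2 : ℤ) = 1)

/-- The set of polynomial Farey fractions of order `Q`. -/
def fareySet (P : Polynomial ℤ) (Q : ℕ) : Finset ℚ :=
  (fareyPairs P Q).image (fun x => (x.1 : ℚ) / (x.2 : ℚ))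

/-- `f_P(m)` is the number of `1 ≤ d ≤ m` with `P(d) ≡ 0 (mod m)`. -/
def fP (P : Polynomial ℤ) (m : ℕ) : ℕ :=
  ((Finset.Icc 1 m).filter (fun d : ℕ => (m : ℤ) ∣ P.eval (d : ℤ))).card

/-- `β_P = ∏_p (1 - f_P(p)/p²)`, the product over all primes. -/
noncomputable def betaP (P : Polynomial ℤ) : ℝ :=
  ∏' p : Nat.Primes, (1 - (fP P (p : ℕ) : ℝ) / ((p : ℕ) : ℝ) ^ 2)

open scoped Classical in
/-- Pair correlation measure `S_F(Λ)` of a finite set `F ⊂ ℝ/ℤ` (represented by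
rationals): `(1/N) · #{(a,b) ∈ F² : a ≠ b, a - b ∈ (1/N)(0,Λ) + ℤ}`. -/
noncomputable def pairCorr (F : Finset ℚ) (Λ : ℝ) : ℝ :=
  (((F ×ˢ F).filter (fun x => x.1 ≠ x.2 ∧
      ∃ k : ℤ, ((x.1 : ℝ) - (x.2 : ℝ) - (k : ℝ)) * (F.card : ℝ) ∈ Set.Ioo 0 Λ)).card : ℝ) /
    (F.card : ℝ)

/-- The polynomial Farey fractions with prime denominators in `B`:
`M_{B,P} = {a/p : 1 ≤ a ≤ p, gcd(P(a), p) = 1, p ∈ B}`. -/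
def fareyPrimeSet (P : Polynomial ℤ) (B : Finset ℕ) : Finset ℚ :=
  B.biUnion fun p =>
    ((Finset.Icc 1 p).filter fun a : ℕ => Int.gcd (P.eval (a : ℤ)) (p : ℤ) = 1).image
      fun a : ℕ => (a : ℚ) / (p : ℚ)


lemma abs_dvd_zero {m d : ℤ} (h : m ∣ d) (h1 : d < m) (h2 : -m < d) : d = 0 := by
  exact Int.eq_zero_of_abs_lt_dvd h (abs_lt.2 ⟨h2, h1⟩)

lemma int_fract_div (p q a b : ℕ) (hp : p ≠ 0) (hq : q ≠ 0) :
    Int.fract ((a : ℝ) / p - (b : ℝ) / q) =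
      ((((a : ℤ) * q - b * p) % ((p * q : ℕ) : ℤ) : ℤ) : ℝ) / ((p * q : ℕ) : ℝ) := by
  rw [← Int.fract_div_intCast_eq_div_intCast_mod]
  congr 1
  have hp' : (p : ℝ) ≠ 0 := by exact_mod_cast hp
  have hq' : (q : ℝ) ≠ 0 := by exact_mod_cast hq
  push_cast
  field_simp

open scoped Classical in
lemma crt_count (p q : ℕ) (hp : p.Prime) (hq : q.Prime) (hpq : p ≠ q) (δ : ℝ)
    (h0 : 0 < δ) (h1 : δ ≤ 1) :
    |((((range p) ×ˢ (range q)).filter (fun x : ℕ × ℕ =>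
      Int.fract ((x.1 : ℝ) / p - (x.2 : ℝ) / q) ∈ Set.Ioo 0 δ)).card : ℝ) - δ * p * q| ≤ 1 := by
  set f : ℕ × ℕ → ℤ := fun x => ((x.1 : ℤ) * q - x.2 * p) % ((p * q : ℕ) : ℤ) with hf
  have hpqpos : 0 < p * q := Nat.mul_pos hp.pos hq.pos
  have hcop : IsCoprime (p : ℤ) (q : ℤ) :=
    Nat.isCoprime_iff_coprime.2 ((Nat.coprime_primes hp hq).2 hpq)
  have hinj : Set.InjOn f ((range p ×ˢ range q : Finset (ℕ × ℕ)) : Set (ℕ × ℕ)) := by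
    rintro ⟨a, b⟩ hab ⟨a', b'⟩ hab' h
    simp only [coe_product, coe_range, Set.mem_prod, Set.mem_Iio] at hab hab'
    have hd : ((p * q : ℕ) : ℤ) ∣ ((a : ℤ) * q - b * p) - ((a' : ℤ) * q - b' * p) :=
      Int.ModEq.dvd (Int.ModEq.symm h)
    push_cast at hd
    have e1 : (p : ℤ) ∣ (a : ℤ) - a' := by
      have : (p : ℤ) ∣ ((a : ℤ) - a') * q := by
        have := (dvd_mul_right (p : ℤ) (q : ℤ)).trans hd
        have h2 := dvd_add this (dvd_mul_left (p : ℤ) ((b : ℤ) - b'))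
        have e := h2; ring_nf at e ⊢; exact e
      exact hcop.dvd_of_dvd_mul_right this
    have e2 : (q : ℤ) ∣ (b : ℤ) - b' := by
      have : (q : ℤ) ∣ ((b : ℤ) - b') * p := by
        have := (dvd_mul_left (q : ℤ) (p : ℤ)).trans hd
        have h2 := dvd_sub (dvd_mul_left (q : ℤ) ((a : ℤ) - a')) this
        have e := h2; ring_nf at e ⊢; exact e
      exact hcop.symm.dvd_of_dvd_mul_right this
    have := abs_dvd_zero e1 (by omega) (by omega)
    have := abs_dvd_zero e2 (by omega) (by omega)
    ext <;> simp <;> omega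
  have himg : (range p ×ˢ range q).image f = Finset.Ico (0 : ℤ) ((p * q : ℕ) : ℤ) := by
    apply Finset.eq_of_subset_of_card_le
    · intro z hz
      obtain ⟨x, _, rfl⟩ := Finset.mem_image.1 hz
      exact Finset.mem_Ico.2 ⟨Int.emod_nonneg _ (by positivity), Int.emod_lt_of_pos _ (by positivity)⟩
    · rw [Finset.card_image_of_injOn hinj]
      simp
  set y : ℝ := δ * p * q with hy
  have hppos : (0 : ℝ) < p := by exact_mod_cast hp.pos
  have hqpos : (0 : ℝ) < q := by exact_mod_cast hq.pos
  have hypos : 0 < y := by positivity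
  have himg2 : ((range p ×ˢ range q).filter (fun x : ℕ × ℕ =>
      Int.fract ((x.1 : ℝ) / p - (x.2 : ℝ) / q) ∈ Set.Ioo 0 δ)).image f = Finset.Ioo 0 ⌈y⌉ := by
    have key : ∀ x : ℕ × ℕ, Int.fract ((x.1 : ℝ) / p - (x.2 : ℝ) / q) ∈ Set.Ioo 0 δ ↔
        (0 < f x ∧ f x < ⌈y⌉) := by
      intro x
      rw [int_fract_div p q x.1 x.2 hp.ne_zero hq.ne_zero, Int.lt_ceil, Set.mem_Ioo]
      change 0 < ((f x : ℤ) : ℝ) / _ ∧ ((f x : ℤ) : ℝ) / _ < δ ↔ _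
      have hc : (0 : ℝ) < ((p * q : ℕ) : ℝ) := by exact_mod_cast hpqpos
      rw [div_lt_iff₀ hc, div_pos_iff_of_pos_right hc]
      rw [hy]; push_cast
      rw [mul_assoc]
      simp
    ext z
    simp only [Finset.mem_image, Finset.mem_filter, key, Finset.mem_Ioo]
    constructor
    · rintro ⟨x, ⟨_, h⟩, rfl⟩
      exact h
    · intro hz
      have : z ∈ (range p ×ˢ range q).image f := by
        rw [himg, Finset.mem_Ico]
        refine ⟨hz.1.le, ?_⟩
        have h3 := Int.lt_ceil.1 hz.2
        have : y ≤ ((p * q : ℕ) : ℝ) := by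
          rw [hy]; push_cast
          nlinarith [mul_pos hppos hqpos]
        have h4 := h3.trans_le this
        exact_mod_cast h4
      obtain ⟨x, hx, rfl⟩ := Finset.mem_image.1 this
      exact ⟨x, ⟨hx, hz⟩, rfl⟩
  rw [← Finset.card_image_of_injOn (f := f) (hinj.mono (by
    intro x hx; exact (Finset.mem_filter.1 hx).1)), himg2, Int.card_Ioo]
  have hcp : 0 < ⌈y⌉ := Int.ceil_pos.2 hypos
  have e : (((⌈y⌉ - 0 - 1).toNat : ℕ) : ℝ) = (⌈y⌉ : ℝ) - 1 := by
    have : (((⌈y⌉ - 0 - 1).toNat : ℕ) : ℤ) = ⌈y⌉ - 1 := by omega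
    exact_mod_cast this
  rw [e]
  have := Int.le_ceil y
  have := Int.ceil_lt_add_one y
  rw [abs_le]; constructor <;> linarith

open scoped Classical in
lemma fract_count (q : ℕ) (hq : 0 < q) (x δ : ℝ) (h0 : 0 < δ) :
    (((range q).filter (fun b : ℕ =>
      Int.fract (x - (b : ℝ) / q) ∈ Set.Ioo 0 δ)).card : ℝ) ≤ δ * q + 1 := by
  have hqpos : (0 : ℝ) < q := by exact_mod_cast hq
  have hle : ((range q).filter (fun b : ℕ =>
      Int.fract (x - (b : ℝ) / q) ∈ Set.Ioo 0 δ)).card ≤ (Finset.Ico 0 ⌈δ * q⌉).card := by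
    apply Finset.card_le_card_of_injOn (fun b : ℕ => ⌊q * Int.fract (x - (b : ℝ) / q)⌋)
    · intro b hb
      have hb := (Finset.mem_filter.1 hb).2
      simp only [coe_Ico, Set.mem_Ico]
      refine ⟨Int.floor_nonneg.2 (mul_nonneg hqpos.le (Int.fract_nonneg _)), ?_⟩
      rw [Int.lt_ceil]
      refine (Int.floor_le _).trans_lt ?_
      nlinarith [hb.2]
    · intro b hb b' hb' h
      have hb := Finset.mem_range.1 (Finset.mem_filter.1 hb).1
      have hb' := Finset.mem_range.1 (Finset.mem_filter.1 hb').1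
      have e : ∀ b : ℕ, ⌊q * Int.fract (x - (b : ℝ) / q)⌋ = ⌊q * x⌋ - (b + q * ⌊x - (b : ℝ) / q⌋) := by
        intro b
        rw [← Int.floor_sub_intCast]
        congr 1
        rw [Int.fract]
        push_cast
        field_simp
        ring
      simp only [e] at h
      have hd : (q : ℤ) ∣ (b : ℤ) - b' := ⟨⌊x - (b' : ℝ) / q⌋ - ⌊x - (b : ℝ) / q⌋, by linarith⟩
      have := abs_dvd_zero hd (by omega) (by omega)
      omega
  have h2 : ((Finset.Ico 0 ⌈δ * q⌉).card : ℝ) = ⌈δ * q⌉ := by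
    rw [Int.card_Ico]
    have hcp : 0 < ⌈δ * q⌉ := Int.ceil_pos.2 (by positivity)
    have : (((⌈δ * q⌉ - 0).toNat : ℕ) : ℤ) = ⌈δ * q⌉ := by omega
    exact_mod_cast this
  have h3 : (((range q).filter (fun b : ℕ =>
      Int.fract (x - (b : ℝ) / q) ∈ Set.Ioo 0 δ)).card : ℝ) ≤ ((Finset.Ico 0 ⌈δ * q⌉).card : ℝ) := by
    exact_mod_cast hle
  have := Int.ceil_lt_add_one (δ * q)
  linarith

open scoped Classical in
lemma fract_count' (q : ℕ) (hq : 0 < q) (x δ : ℝ) (h0 : 0 < δ) :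
    (((range q).filter (fun b : ℕ =>
      Int.fract ((b : ℝ) / q - x) ∈ Set.Ioo 0 δ)).card : ℝ) ≤ δ * q + 1 := by
  have hqpos : (0 : ℝ) < q := by exact_mod_cast hq
  have hle : ((range q).filter (fun b : ℕ =>
      Int.fract ((b : ℝ) / q - x) ∈ Set.Ioo 0 δ)).card ≤ (Finset.Ico 0 ⌈δ * q⌉).card := by
    apply Finset.card_le_card_of_injOn (fun b : ℕ => ⌊q * Int.fract ((b : ℝ) / q - x)⌋)
    · intro b hb
      have hb := (Finset.mem_filter.1 hb).2
      simp only [coe_Ico, Set.mem_Ico]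
      refine ⟨Int.floor_nonneg.2 (mul_nonneg hqpos.le (Int.fract_nonneg _)), ?_⟩
      rw [Int.lt_ceil]
      refine (Int.floor_le _).trans_lt ?_
      nlinarith [hb.2]
    · intro b hb b' hb' h
      have hb := Finset.mem_range.1 (Finset.mem_filter.1 hb).1
      have hb' := Finset.mem_range.1 (Finset.mem_filter.1 hb').1
      have e : ∀ b : ℕ, ⌊q * Int.fract ((b : ℝ) / q - x)⌋ = ⌊-(q * x)⌋ + (b - q * ⌊(b : ℝ) / q - x⌋) := by
        intro b
        rw [← Int.floor_add_intCast]
        congr 1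
        rw [Int.fract]
        push_cast
        field_simp
        ring
      simp only [e] at h
      have hd : (q : ℤ) ∣ (b : ℤ) - b' := ⟨⌊(b : ℝ) / q - x⌋ - ⌊(b' : ℝ) / q - x⌋, by linarith⟩
      have := abs_dvd_zero hd (by omega) (by omega)
      omega
  have h2 : ((Finset.Ico 0 ⌈δ * q⌉).card : ℝ) = ⌈δ * q⌉ := by
    rw [Int.card_Ico]
    have hcp : 0 < ⌈δ * q⌉ := Int.ceil_pos.2 (by positivity)
    have : (((⌈δ * q⌉ - 0).toNat : ℕ) : ℤ) = ⌈δ * q⌉ := by omega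
    exact_mod_cast this
  have h3 : (((range q).filter (fun b : ℕ =>
      Int.fract ((b : ℝ) / q - x) ∈ Set.Ioo 0 δ)).card : ℝ) ≤ ((Finset.Ico 0 ⌈δ * q⌉).card : ℝ) := by
    exact_mod_cast hle
  have := Int.ceil_lt_add_one (δ * q)
  linarith

def aSet (P : Polynomial ℤ) (p : ℕ) : Finset ℕ :=
  (Finset.Icc 1 p).filter fun a : ℕ => Int.gcd (P.eval (a : ℤ)) (p : ℤ) = 1

lemma aSet_subset (P : Polynomial ℤ) (h0 : P.eval 0 = 0) (p : ℕ) (hp : p.Prime) :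
    aSet P p ⊆ range p := by
  intro a ha
  obtain ⟨h1, h2⟩ := Finset.mem_filter.1 ha
  rw [Finset.mem_Icc] at h1
  rw [Finset.mem_range]
  refine lt_of_le_of_ne h1.2 ?_
  rintro rfl
  have hd : (a : ℤ) ∣ P.eval (a : ℤ) := by
    have := Polynomial.sub_dvd_eval_sub (a : ℤ) 0 P
    simpa [h0] using this
  have h3 := (Int.gcd_eq_right_iff_dvd (by positivity)).2 hd
  rw [h2] at h3
  exact hp.one_lt.ne' (by exact_mod_cast h3.symm)

lemma sdiff_card_le (P : Polynomial ℤ) (hP : P ≠ 0) (h0 : P.eval 0 = 0) (p : ℕ) (hp : p.Prime) :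
    (range p \ aSet P p).card ≤ P.natDegree + P.leadingCoeff.natAbs := by
  by_cases hd : (p : ℤ) ∣ P.leadingCoeff
  · have h1 : (range p \ aSet P p).card ≤ p :=
      (Finset.card_le_card Finset.sdiff_subset).trans (by simp)
    have h2 : p ≤ P.leadingCoeff.natAbs :=
      Nat.le_of_dvd (Int.natAbs_pos.2 (by simpa using hP)) (Int.natCast_dvd.1 hd)
    omega
  · have : Fact p.Prime := ⟨hp⟩
    set R := P.map (Int.castRingHom (ZMod p)) with hR
    have hR0 : R ≠ 0 := by
      intro h
      have := congrArg (fun r => Polynomial.coeff r P.natDegree) h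
      simp only [hR, Polynomial.coeff_map, Polynomial.coeff_zero] at this
      apply hd
      exact (ZMod.intCast_zmod_eq_zero_iff_dvd _ p).1 (by simpa using this)
    have h1 : (range p \ aSet P p).card ≤ R.roots.toFinset.card := by
      apply Finset.card_le_card_of_injOn (fun a : ℕ => (a : ZMod p))
      · intro a ha
        have ha := Finset.mem_sdiff.1 ha
        have hdv : (p : ℤ) ∣ P.eval (a : ℤ) := by
          by_contra hcon
          have hmem := Finset.mem_range.1 ha.1
          apply ha.2
          refine Finset.mem_filter.2 ⟨Finset.mem_Icc.2 ⟨?_, hmem.le⟩, ?_⟩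
          · rcases Nat.eq_zero_or_pos a with rfl | h
            · simp [h0] at hcon
            · exact h
          · rw [← Int.isCoprime_iff_gcd_eq_one]
            exact ((Nat.prime_iff_prime_int.1 hp).irreducible.coprime_iff_not_dvd.2 hcon).symm
        simp only [Finset.mem_coe, Multiset.mem_toFinset, Polynomial.mem_roots hR0,
          Polynomial.IsRoot.def]
        have := (ZMod.intCast_zmod_eq_zero_iff_dvd _ p).2 hdv
        rw [hR, Polynomial.eval_map, Polynomial.eval₂_at_natCast]
        simpa using this
      · intro a ha b hb h
        have ha := Finset.mem_range.1 (Finset.mem_sdiff.1 ha).1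
        have hb := Finset.mem_range.1 (Finset.mem_sdiff.1 hb).1
        have := (ZMod.natCast_eq_natCast_iff' _ _ _).1 h
        rwa [Nat.mod_eq_of_lt ha, Nat.mod_eq_of_lt hb] at this
    have h2 := Multiset.toFinset_card_le R.roots
    have h3 := R.card_roots'
    have h4 : R.natDegree ≤ P.natDegree := Polynomial.natDegree_map_le
    omega

lemma sum_fareyPrimeSet (P : Polynomial ℤ) (h0 : P.eval 0 = 0) (B : Finset ℕ)
    (hB : ∀ p ∈ B, p.Prime) {M : Type*} [AddCommMonoid M] (g : ℚ → M) :
    ∑ x ∈ fareyPrimeSet P B, g x = ∑ p ∈ B, ∑ a ∈ aSet P p, g ((a : ℚ) / p) := by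
  have hden : ∀ p ∈ B, ∀ a ∈ aSet P p, ((a : ℚ) / p).den = p ∧ ((a : ℚ) / p).num = a := by
    intro p hp a ha
    have hlt := Finset.mem_range.1 (aSet_subset P h0 p (hB p hp) ha)
    have hpos := (Finset.mem_Icc.1 (Finset.mem_filter.1 ha).1).1
    have hc : Nat.Coprime a p := 
      (Nat.coprime_of_lt_prime (by omega) hlt (hB p hp)).symm
    have h1 := Rat.den_div_eq_of_coprime (a := a) (b := p) (by exact_mod_cast (hB p hp).pos) (by simpa using hc)
    have h2 := Rat.num_div_eq_of_coprime (a := a) (b := p) (by exact_mod_cast (hB p hp).pos) (by simpa using hc)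
    constructor
    · have h1 : (((a : ℚ) / p).den : ℤ) = p := by simpa using h1
      exact_mod_cast h1
    · simpa using h2
  unfold fareyPrimeSet
  rw [Finset.sum_biUnion]
  · apply Finset.sum_congr rfl
    intro p hp
    rw [Finset.sum_image]
    · rfl
    · intro a ha b hb h
      have h1 := (hden p hp a ha).2
      have h2 := (hden p hp b hb).2
      simp only at h
      rw [h] at h1
      exact_mod_cast h1.symm.trans h2
  · intro p hp q hq hpq
    rw [Function.onFun, Finset.disjoint_left]
    rintro x hx hy
    obtain ⟨a, ha, rfl⟩ := Finset.mem_image.1 hx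
    obtain ⟨b, hb, h⟩ := Finset.mem_image.1 hy
    have h1 := (hden p hp a ha).1
    have h2 := (hden q hq b hb).1
    rw [h] at h2
    exact hpq (h1.symm.trans h2)

open scoped Classical in
noncomputable def cCount (P : Polynomial ℤ) (δ : ℝ) (p q : ℕ) : ℝ :=
  (((aSet P p) ×ˢ (aSet P q)).filter (fun x : ℕ × ℕ =>
      Int.fract ((x.1 : ℝ) / p - (x.2 : ℝ) / q) ∈ Set.Ioo 0 δ)).card

lemma cCount_cross (P : Polynomial ℤ) (h0 : P.eval 0 = 0) (K : ℕ)
    (hK : ∀ p : ℕ, p.Prime → (range p \ aSet P p).card ≤ K)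
    (p q : ℕ) (hp : p.Prime) (hq : q.Prime) (hpq : p ≠ q) (δ : ℝ)
    (hδ : 0 < δ) (h1 : δ ≤ 1) :
    |cCount P δ p q - δ * p * q| ≤ 1 + K * (δ * p + 1) + K * (δ * q + 1) := by
  classical
  have hT := crt_count p q hp hq hpq δ hδ h1
  set C : ℕ × ℕ → Prop := fun x =>
      Int.fract ((x.1 : ℝ) / p - (x.2 : ℝ) / q) ∈ Set.Ioo 0 δ with hC
  set T := ((range p) ×ˢ (range q)).filter C with hTdef
  set S := ((aSet P p) ×ˢ (aSet P q)).filter C with hS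
  set Z1 := (range p \ aSet P p).biUnion (fun a => ((range q).filter (fun b : ℕ => C (a, b))).image (fun b => (a, b))) with hZ1
  set Z2 := (range q \ aSet P q).biUnion (fun b => ((range p).filter (fun a : ℕ => C (a, b))).image (fun a => (a, b))) with hZ2
  have hc : cCount P δ p q = (S.card : ℝ) := by
    unfold cCount; rw [hS]
  have hST : S ⊆ T := by
    apply Finset.filter_subset_filter
    exact Finset.product_subset_product (aSet_subset P h0 p hp) (aSet_subset P h0 q hq)
  have hTS : T ⊆ S ∪ (Z1 ∪ Z2) := by
    rintro ⟨a, b⟩ hab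
    obtain ⟨h2, h3⟩ := Finset.mem_filter.1 hab
    obtain ⟨ha, hb⟩ := Finset.mem_product.1 h2
    by_cases haA : a ∈ aSet P p
    · by_cases hbA : b ∈ aSet P q
      · exact Finset.mem_union_left _ (Finset.mem_filter.2 ⟨Finset.mem_product.2 ⟨haA, hbA⟩, h3⟩)
      · refine Finset.mem_union_right _ (Finset.mem_union_right _ ?_)
        refine Finset.mem_biUnion.2 ⟨b, Finset.mem_sdiff.2 ⟨hb, hbA⟩, Finset.mem_image.2 ⟨a, ?_, rfl⟩⟩
        exact Finset.mem_filter.2 ⟨ha, h3⟩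
    · refine Finset.mem_union_right _ (Finset.mem_union_left _ ?_)
      refine Finset.mem_biUnion.2 ⟨a, Finset.mem_sdiff.2 ⟨ha, haA⟩, Finset.mem_image.2 ⟨b, ?_, rfl⟩⟩
      exact Finset.mem_filter.2 ⟨hb, h3⟩
  have hz1 : (Z1.card : ℝ) ≤ K * (δ * q + 1) := by
    calc (Z1.card : ℝ) ≤ ∑ a ∈ range p \ aSet P p, (δ * q + 1) := by
          refine le_trans (Nat.cast_le.2 Finset.card_biUnion_le) ?_
          push_cast
          apply Finset.sum_le_sum
          intro a _
          refine le_trans (Nat.cast_le.2 Finset.card_image_le) ?_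
          exact fract_count q hq.pos ((a : ℝ) / p) δ hδ
      _ ≤ K * (δ * q + 1) := by
          rw [Finset.sum_const, nsmul_eq_mul]
          have : ((range p \ aSet P p).card : ℝ) ≤ K := by exact_mod_cast hK p hp
          gcongr
  have hz2 : (Z2.card : ℝ) ≤ K * (δ * p + 1) := by
    calc (Z2.card : ℝ) ≤ ∑ a ∈ range q \ aSet P q, (δ * p + 1) := by
          refine le_trans (Nat.cast_le.2 Finset.card_biUnion_le) ?_
          push_cast
          apply Finset.sum_le_sum
          intro b _
          refine le_trans (Nat.cast_le.2 Finset.card_image_le) ?_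
          exact fract_count' p hp.pos ((b : ℝ) / q) δ hδ
      _ ≤ K * (δ * p + 1) := by
          rw [Finset.sum_const, nsmul_eq_mul]
          have : ((range q \ aSet P q).card : ℝ) ≤ K := by exact_mod_cast hK q hq
          gcongr
  have e1 : (S.card : ℝ) ≤ T.card := by exact_mod_cast Finset.card_le_card hST
  have e2 : (T.card : ℝ) ≤ S.card + (Z1.card + Z2.card) := by
    have := (Finset.card_le_card hTS).trans ((Finset.card_union_le _ _).trans
      (Nat.add_le_add_left (Finset.card_union_le _ _) _))
    exact_mod_cast this
  rw [hc]
  have hT := abs_le.1 hT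
  have : 0 ≤ (K : ℝ) * (δ * p + 1) := by positivity
  have : 0 ≤ (K : ℝ) * (δ * q + 1) := by positivity
  rw [abs_le]; constructor <;> linarith [hT.1, hT.2]

lemma cCount_nonneg (P : Polynomial ℤ) (δ : ℝ) (p q : ℕ) : 0 ≤ cCount P δ p q := by
  unfold cCount; positivity

lemma cCount_diag (P : Polynomial ℤ) (p : ℕ) (hp : 0 < p) (δ : ℝ) (h : δ * p ≤ 1) :
    cCount P δ p p = 0 := by
  unfold cCount
  norm_cast
  rw [Finset.card_eq_zero, Finset.filter_eq_empty_iff]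
  rintro ⟨a, b⟩ _ hx
  have hpp : (0 : ℝ) < p := by exact_mod_cast hp
  have e : (a : ℝ) / p - (b : ℝ) / p = (((a : ℤ) - b : ℤ) : ℝ) / p := by
    push_cast; ring
  simp only [e, Int.fract_div_intCast_eq_div_intCast_mod, Set.mem_Ioo] at hx
  obtain ⟨h1, h2⟩ := hx
  rw [div_pos_iff_of_pos_right hpp] at h1
  rw [div_lt_iff₀ hpp] at h2
  have h1 : 0 < ((a : ℤ) - b) % (p : ℤ) := by exact_mod_cast h1
  have h3 : (((((a : ℤ) - b) % (p : ℤ) : ℤ)) : ℝ) < 1 := h2.trans_le h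
  have h3 : ((a : ℤ) - b) % (p : ℤ) < 1 := by exact_mod_cast h3
  omega

lemma fract_cond (x N Λ : ℝ) (hN : 0 < N) (h : Λ ≤ N) :
    (∃ k : ℤ, (x - (k : ℝ)) * N ∈ Set.Ioo 0 Λ) ↔ Int.fract x ∈ Set.Ioo 0 (Λ / N) := by
  simp only [Set.mem_Ioo, lt_div_iff₀ hN]
  constructor
  · rintro ⟨k, h1, h2⟩
    have h3 : 0 < x - k := by
      by_contra hc
      nlinarith
    have h4 : x - k < 1 := by
      by_contra hc
      nlinarith
    have : ⌊x⌋ = k := by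
      rw [Int.floor_eq_iff]; constructor <;> linarith
    rw [Int.fract, this]
    exact ⟨h3, h2⟩
  · rintro ⟨h1, h2⟩
    exact ⟨⌊x⌋, mul_pos h1 hN, h2⟩

lemma pairCorr_eq (P : Polynomial ℤ) (h0 : P.eval 0 = 0) (B : Finset ℕ)
    (hB : ∀ p ∈ B, p.Prime) (Λ : ℝ) (N : ℝ) (hN : N = ((fareyPrimeSet P B).card : ℝ))
    (hNpos : 0 < N) (hΛ : Λ ≤ N) :
    pairCorr (fareyPrimeSet P B) Λ =
      (∑ p ∈ B, ∑ q ∈ B, cCount P (Λ / N) p q) / N := by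
  classical
  unfold pairCorr
  rw [← hN]
  congr 1
  have key : ∀ x : ℚ × ℚ, (x.1 ≠ x.2 ∧
      ∃ k : ℤ, ((x.1 : ℝ) - (x.2 : ℝ) - (k : ℝ)) * N ∈ Set.Ioo 0 Λ) ↔
      Int.fract ((x.1 : ℝ) - (x.2 : ℝ)) ∈ Set.Ioo 0 (Λ / N) := by
    intro x
    rw [fract_cond _ N Λ hNpos hΛ, and_iff_right_iff_imp]
    intro h hx
    rw [hx] at h
    simp at h
  simp only [key]
  rw [Finset.card_filter]
  push_cast
  rw [Finset.sum_product, sum_fareyPrimeSet P h0 B hB]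
  apply Finset.sum_congr rfl
  intro p hp
  simp_rw [sum_fareyPrimeSet P h0 B hB]
  rw [Finset.sum_comm]
  apply Finset.sum_congr rfl
  intro q hq
  unfold cCount
  rw [Finset.card_filter]
  push_cast
  rw [Finset.sum_product]

lemma card_eq (P : Polynomial ℤ) (h0 : P.eval 0 = 0) (B : Finset ℕ)
    (hB : ∀ p ∈ B, p.Prime) : (fareyPrimeSet P B).card = ∑ p ∈ B, (aSet P p).card := by
  rw [Finset.card_eq_sum_ones, sum_fareyPrimeSet P h0 B hB]
  simp

lemma card_bounds (P : Polynomial ℤ) (h0 : P.eval 0 = 0) (K : ℕ)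
    (hK : ∀ p : ℕ, p.Prime → (range p \ aSet P p).card ≤ K) (B : Finset ℕ)
    (hB : ∀ p ∈ B, p.Prime) :
    ((fareyPrimeSet P B).card : ℝ) ≤ ∑ p ∈ B, (p : ℝ) ∧
    ∑ p ∈ B, (p : ℝ) ≤ ((fareyPrimeSet P B).card : ℝ) + K * B.card := by
  have h : ∀ p ∈ B, (aSet P p).card ≤ p ∧ p ≤ (aSet P p).card + K := by
    intro p hp
    have h1 := Finset.card_le_card (aSet_subset P h0 p (hB p hp))
    have h2 := hK p (hB p hp)
    have h3 := Finset.card_sdiff_add_card_eq_card (aSet_subset P h0 p (hB p hp))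
    rw [Finset.card_range] at h1 h3
    omega
  rw [card_eq P h0 B hB]
  push_cast
  constructor
  · exact Finset.sum_le_sum fun p hp => by exact_mod_cast (h p hp).1
  · rw [mul_comm, ← nsmul_eq_mul, ← Finset.sum_const, ← Finset.sum_add_distrib]
    exact Finset.sum_le_sum fun p hp => by exact_mod_cast (h p hp).2

lemma prime_sum_ge (C : ℝ) (hC : 0 < C) : ∃ k0 : ℕ, ∀ B : Finset ℕ, (∀ p ∈ B, p.Prime) →
    k0 ≤ B.card → C * (B.card : ℝ) ^ 2 ≤ ∑ p ∈ B, (p : ℝ) := by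
  have h1 := Chebyshev.eventually_primeCounting_le (ε := 1) one_pos
  have h2 : ∀ᶠ x : ℝ in atTop, 8 * C * (Real.log 4 + 1) ≤ Real.log x :=
    Real.tendsto_log_atTop.eventually_ge_atTop _
  have h3 : Tendsto (fun k : ℕ => 4 * C * (k : ℝ)) atTop atTop :=
    tendsto_natCast_atTop_atTop.const_mul_atTop (by positivity)
  obtain ⟨k0, hk0⟩ := eventually_atTop.1 (h3.eventually (h1.and (h2.and (eventually_gt_atTop 1))))
  refine ⟨k0, fun B hB hk => ?_⟩
  obtain ⟨e1, e2, e3⟩ := hk0 _ hk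
  set k := B.card with hkd
  set x : ℝ := 4 * C * k with hx
  have hlog : 0 < Real.log x := Real.log_pos e3
  have e4 : ((Nat.primeCounting ⌊x⌋₊ : ℕ) : ℝ) ≤ k / 2 := by
    refine e1.trans ?_
    rw [div_le_iff₀ hlog]
    have : (k : ℝ) / 2 * (8 * C * (Real.log 4 + 1)) ≤ k / 2 * Real.log x := by gcongr
    refine le_trans (le_of_eq ?_) this
    rw [hx]; ring
  have e5 : (B.filter (fun p => p ≤ ⌊x⌋₊)).card ≤ Nat.primeCounting ⌊x⌋₊ := by
    rw [← Nat.primesLE_card_eq_primeCounting]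
    apply Finset.card_le_card
    intro p hp
    have := Finset.mem_filter.1 hp
    rw [Nat.mem_primesLE]
    exact ⟨this.2, hB p this.1⟩
  have e6 := Finset.card_filter_add_card_filter_not (s := B) (fun p => p ≤ ⌊x⌋₊)
  have e7 : (k : ℝ) / 2 ≤ ((B.filter (fun p => ¬ p ≤ ⌊x⌋₊)).card : ℝ) := by
    have e6' : ((B.filter (fun p => p ≤ ⌊x⌋₊)).card : ℝ) +
      ((B.filter (fun p => ¬ p ≤ ⌊x⌋₊)).card : ℝ) = k := by exact_mod_cast e6
    have e5' : ((B.filter (fun p => p ≤ ⌊x⌋₊)).card : ℝ) ≤ Nat.primeCounting ⌊x⌋₊ := by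
      exact_mod_cast e5
    linarith
  have hxpos : 0 < x := by linarith
  calc C * (k : ℝ) ^ 2 ≤ k / 2 * x := by
        rw [hx]; nlinarith [mul_nonneg hC.le (sq_nonneg (k : ℝ))]
    _ ≤ ((B.filter (fun p => ¬ p ≤ ⌊x⌋₊)).card : ℝ) * x := by gcongr
    _ = ∑ p ∈ B.filter (fun p => ¬ p ≤ ⌊x⌋₊), x := by rw [Finset.sum_const, nsmul_eq_mul]
    _ ≤ ∑ p ∈ B.filter (fun p => ¬ p ≤ ⌊x⌋₊), (p : ℝ) := by
        apply Finset.sum_le_sum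
        intro p hp
        have := (Finset.mem_filter.1 hp).2
        exact (Nat.lt_of_floor_lt (not_le.1 this)).le
    _ ≤ ∑ p ∈ B, (p : ℝ) :=
        Finset.sum_le_sum_of_subset_of_nonneg (Finset.filter_subset _ _) (fun _ _ _ => by positivity)

lemma double_sum_bound (P : Polynomial ℤ) (h0 : P.eval 0 = 0) (K : ℕ)
    (hK : ∀ p : ℕ, p.Prime → (range p \ aSet P p).card ≤ K) (B : Finset ℕ)
    (hB : ∀ p ∈ B, p.Prime) (δ : ℝ) (hδ : 0 < δ) (h1 : δ ≤ 1) (hd : ∀ p ∈ B, δ * p ≤ 1) :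
    |∑ p ∈ B, ∑ q ∈ B, cCount P δ p q - δ * ((∑ p ∈ B, (p : ℝ)) ^ 2 - ∑ p ∈ B, (p : ℝ) ^ 2)| ≤
      (1 + 2 * K) * (B.card : ℝ) ^ 2 + 2 * K * δ * B.card * ∑ p ∈ B, (p : ℝ) := by
  have e : ∑ p ∈ B, ∑ q ∈ B, cCount P δ p q -
      δ * ((∑ p ∈ B, (p : ℝ)) ^ 2 - ∑ p ∈ B, (p : ℝ) ^ 2) =
      ∑ p ∈ B, ∑ q ∈ B, (cCount P δ p q - δ * p * q + if p = q then δ * (p : ℝ) ^ 2 else 0) := by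
    simp only [Finset.sum_add_distrib, Finset.sum_sub_distrib, Finset.sum_ite_eq]
    have e1 : ∑ p ∈ B, ∑ q ∈ B, δ * (p : ℝ) * q = δ * (∑ p ∈ B, (p : ℝ)) ^ 2 := by
      rw [sq, Finset.sum_mul_sum, Finset.mul_sum]
      refine Finset.sum_congr rfl fun p _ => ?_
      rw [Finset.mul_sum]
      exact Finset.sum_congr rfl fun q _ => by ring
    have e2 : ∑ p ∈ B, (if p ∈ B then δ * (p : ℝ) ^ 2 else 0) = δ * ∑ p ∈ B, (p : ℝ) ^ 2 := by
      rw [Finset.mul_sum]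
      exact Finset.sum_congr rfl fun p hp => by rw [if_pos hp]
    rw [e1, e2]; ring
  rw [e]
  refine (Finset.abs_sum_le_sum_abs _ _).trans ?_
  have hb : ∀ p ∈ B, |∑ q ∈ B, (cCount P δ p q - δ * p * q + if p = q then δ * (p : ℝ) ^ 2 else 0)| ≤
      ∑ q ∈ B, ((1 + 2 * K) + K * δ * p + K * δ * q : ℝ) := by
    intro p hp
    refine (Finset.abs_sum_le_sum_abs _ _).trans (Finset.sum_le_sum fun q hq => ?_)
    by_cases h : p = q
    · subst h
      rw [if_pos rfl, cCount_diag P p (hB p hp).pos δ (hd p hp)]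
      have : (0 : ℝ) - δ * p * p + δ * (p : ℝ) ^ 2 = 0 := by ring
      rw [this, abs_zero]
      positivity
    · rw [if_neg h, add_zero]
      refine (cCount_cross P h0 K hK p q (hB p hp) (hB q hq) h δ hδ h1).trans (le_of_eq ?_)
      ring
  refine (Finset.sum_le_sum hb).trans (le_of_eq ?_)
  simp only [Finset.sum_add_distrib, Finset.sum_const, nsmul_eq_mul, ← Finset.mul_sum]
  ring

lemma main_bound (P : Polynomial ℤ) (h0 : P.eval 0 = 0) (K : ℕ)
    (hK : ∀ p : ℕ, p.Prime → (range p \ aSet P p).card ≤ K) (B : Finset ℕ)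
    (hB : ∀ p ∈ B, p.Prime) (Λ : ℝ) (hΛ : 0 < Λ) (N S : ℝ)
    (hN : N = ((fareyPrimeSet P B).card : ℝ)) (hS : S = ∑ p ∈ B, (p : ℝ))
    (hd : ∀ p ∈ B, Λ * p ≤ N) (hΛN : Λ ≤ N) (hSN : S ≤ 2 * N) (hk : 1 ≤ B.card) :
    |pairCorr (fareyPrimeSet P B) Λ - Λ * (1 - (∑ p ∈ B, (p : ℝ) ^ 2) / N ^ 2)| ≤
      (2 * (1 + 2 * K) + 14 * K * Λ) * ((B.card : ℝ) ^ 2 / S) := by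
  have hNpos : 0 < N := hΛ.trans_le hΛN
  obtain ⟨b1, b2⟩ := card_bounds P h0 K hK B hB
  rw [← hN, ← hS] at b1 b2
  have hSpos : 0 < S := hNpos.trans_le b1
  rw [pairCorr_eq P h0 B hB Λ N hN hNpos hΛN]
  have hδ : 0 < Λ / N := by positivity
  have hb := double_sum_bound P h0 K hK B hB (Λ / N) hδ (by rwa [div_le_one hNpos])
    (fun p hp => by rw [div_mul_eq_mul_div, div_le_one hNpos]; exact hd p hp)
  rw [← hS] at hb
  set T := ∑ p ∈ B, ∑ q ∈ B, cCount P (Λ / N) p q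
  set S2 := ∑ p ∈ B, (p : ℝ) ^ 2
  set k : ℝ := (B.card : ℝ) with hkd
  have hk1 : 1 ≤ k := by rw [hkd]; exact_mod_cast hk
  have hkk : k ≤ k ^ 2 := by nlinarith
  set r := k ^ 2 / S with hr
  have r0 : 0 ≤ r := by positivity
  have a1 : k ^ 2 / N ≤ 2 * r := by
    rw [hr, div_le_iff₀ hNpos, mul_div_assoc', div_mul_eq_mul_div, le_div_iff₀ hSpos]
    nlinarith [sq_nonneg k]
  have a2 : k / N ≤ 2 * r := le_trans (by gcongr) a1
  have a3 : S / N ≤ 2 := by rw [div_le_iff₀ hNpos]; exact hSN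
  have key : T / N - Λ * (1 - S2 / N ^ 2) =
      (T - Λ / N * (S ^ 2 - S2)) / N + Λ * ((S - N) / N * (S / N + 1)) := by
    field_simp
    ring
  rw [key]
  refine (abs_add_le _ _).trans ?_
  have c1 : |(T - Λ / N * (S ^ 2 - S2)) / N| ≤ (1 + 2 * K) * (2 * r) + 2 * K * Λ * (2 * r) * 2 := by
    rw [abs_div, abs_of_pos hNpos]
    calc _ ≤ ((1 + 2 * K) * k ^ 2 + 2 * K * (Λ / N) * k * S) / N := by gcongr
      _ = (1 + 2 * K) * (k ^ 2 / N) + 2 * K * Λ * (k / N) * (S / N) := by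
        field_simp
      _ ≤ _ := by gcongr
  have c2 : |Λ * ((S - N) / N * (S / N + 1))| ≤ Λ * (K * (2 * r) * (2 + 1)) := by
    have : 0 ≤ S - N := by linarith
    rw [abs_of_nonneg (by positivity)]
    have : (S - N) / N ≤ K * (2 * r) := by
      calc (S - N) / N ≤ (K * k) / N := by gcongr; linarith
        _ = K * (k / N) := by ring
        _ ≤ _ := by gcongr
    gcongr
  refine (add_le_add c1 c2).trans (le_of_eq ?_)
  ring

lemma tendsto_key (P : Polynomial ℤ) (hP0 : P ≠ 0) (h0 : P.eval 0 = 0)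
    (B : ℕ → Finset ℕ) (hB : ∀ Q : ℕ, ∀ p ∈ B Q, Nat.Prime p)
    (hBcard : Tendsto (fun Q : ℕ => (B Q).card) atTop atTop) :
    (∀ᶠ Q in atTop, ∑ p ∈ B Q, (p : ℝ) ≤ 2 * ((fareyPrimeSet P (B Q)).card : ℝ)) ∧
    ∀ Λ : ℝ, 0 < Λ → (∀ᶠ Q in atTop, ∀ p ∈ B Q, Λ * p ≤ ((fareyPrimeSet P (B Q)).card : ℝ)) →
    Tendsto (fun Q => pairCorr (fareyPrimeSet P (B Q)) Λ - Λ * (1 -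
      (∑ p ∈ B Q, (p : ℝ) ^ 2) / ((fareyPrimeSet P (B Q)).card : ℝ) ^ 2)) atTop (nhds 0) := by
  obtain ⟨K, hK⟩ : ∃ K : ℕ, ∀ p : ℕ, p.Prime → (range p \ aSet P p).card ≤ K :=
    ⟨_, fun p hp => sdiff_card_le P hP0 h0 p hp⟩
  have hr : ∀ C : ℝ, 0 < C → ∀ᶠ Q in atTop, C * ((B Q).card : ℝ) ^ 2 ≤ ∑ p ∈ B Q, (p : ℝ) := by
    intro C hC
    obtain ⟨k0, hk0⟩ := prime_sum_ge C hC
    filter_upwards [hBcard.eventually_ge_atTop k0] with Q hQ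
    exact hk0 _ (hB Q) hQ
  have hSN : ∀ᶠ Q in atTop, ∑ p ∈ B Q, (p : ℝ) ≤ 2 * ((fareyPrimeSet P (B Q)).card : ℝ) := by
    filter_upwards [hr (2 * K + 1) (by positivity), hBcard.eventually_ge_atTop 1] with Q h1 h2
    obtain ⟨b1, b2⟩ := card_bounds P h0 K hK (B Q) (hB Q)
    have hk1 : (1 : ℝ) ≤ (B Q).card := by exact_mod_cast h2
    have : (K : ℝ) * (B Q).card ≤ K * (B Q).card ^ 2 := by
      gcongr; nlinarith
    nlinarith [sq_nonneg ((B Q).card : ℝ)]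
  refine ⟨hSN, fun Λ hΛ hd => ?_⟩
  have hNbig : ∀ᶠ Q in atTop, Λ ≤ ((fareyPrimeSet P (B Q)).card : ℝ) := by
    filter_upwards [hr (2 * Λ) (by positivity), hBcard.eventually_ge_atTop 1, hSN] with Q h1 h2 h3
    have hk1 : (1 : ℝ) ≤ (B Q).card := by exact_mod_cast h2
    have hk2 : (1 : ℝ) ≤ ((B Q).card : ℝ) ^ 2 := one_le_pow₀ hk1
    have := mul_le_mul_of_nonneg_left hk2 hΛ.le
    linarith
  have hr0 : Tendsto (fun Q => ((B Q).card : ℝ) ^ 2 / ∑ p ∈ B Q, (p : ℝ)) atTop (nhds 0) := by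
    rw [Metric.tendsto_nhds]
    intro ε hε
    filter_upwards [hr (2 / ε) (by positivity), hBcard.eventually_ge_atTop 1] with Q h1 h2
    have hk1 : (1 : ℝ) ≤ (B Q).card := by exact_mod_cast h2
    have hpos : 0 < ∑ p ∈ B Q, (p : ℝ) := lt_of_lt_of_le (by positivity) h1
    rw [Real.dist_eq, sub_zero, abs_of_nonneg (by positivity), div_lt_iff₀ hpos]
    have : ε * (2 / ε * ((B Q).card : ℝ) ^ 2) = 2 * ((B Q).card : ℝ) ^ 2 := by field_simp
    nlinarith [mul_le_mul_of_nonneg_left h1 hε.le]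
  apply squeeze_zero_norm' (a := fun Q => (2 * (1 + 2 * K) + 14 * K * Λ) * (((B Q).card : ℝ) ^ 2 / ∑ p ∈ B Q, (p : ℝ)))
  · filter_upwards [hd, hNbig, hSN, hBcard.eventually_ge_atTop 1] with Q h1 h2 h3 h4
    exact main_bound P h0 K hK (B Q) (hB Q) Λ hΛ _ _ rfl rfl h1 h2 h3 h4
  · simpa using hr0.const_mul (2 * (1 + 2 * K) + 14 * K * Λ)

/-- **Theorem.** The limiting pair correlation of `(M_{B_Q,P})_Q` exists and is
Poissonian if and only if `Σ_{p ∈ B_Q} p² = o((#M_{B_Q,P})²)`. -/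
theorem pairCorr_fareyPrime_poissonian_iff (ν : ℕ) (hν : 2 ≤ ν) (c : ℕ → ℤ) (hc : c ν ≠ 0)
    (P : Polynomial ℤ)
    (hP : P = ∑ i ∈ Finset.Icc 1 ν, Polynomial.C (c i) * Polynomial.X ^ i)
    (hdisc : (P.map (Int.castRingHom ℚ)).Separable)
    (B : ℕ → Finset ℕ) (hB : ∀ Q : ℕ, ∀ p ∈ B Q, Nat.Prime p ∧ p ≤ Q)
    (hBcard : Tendsto (fun Q : ℕ => (B Q).card) atTop atTop) :
    (∀ Λ : ℝ, 0 < Λ →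
        Tendsto (fun Q : ℕ => pairCorr (fareyPrimeSet P (B Q)) Λ) atTop (nhds Λ)) ↔
      Tendsto (fun Q : ℕ =>
          (∑ p ∈ B Q, (p : ℝ) ^ 2) / ((fareyPrimeSet P (B Q)).card : ℝ) ^ 2)
        atTop (nhds 0) := by

  have h0 : P.eval 0 = 0 := by
    rw [hP, Polynomial.eval_finset_sum]
    apply Finset.sum_eq_zero
    intro i hi
    have := (Finset.mem_Icc.1 hi).1
    simp [show i ≠ 0 by omega]
  have hP0 : P ≠ 0 := by
    intro h
    have h1 : P.coeff ν = c ν := by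
      rw [hP, Polynomial.finset_sum_coeff]
      simp only [Polynomial.coeff_C_mul, Polynomial.coeff_X_pow, mul_ite, mul_one, mul_zero]
      rw [Finset.sum_ite_eq, if_pos (Finset.mem_Icc.2 ⟨by omega, le_rfl⟩)]
    rw [h] at h1
    exact hc (by simpa using h1.symm)
  obtain ⟨hSN, key⟩ := tendsto_key P hP0 h0 B (fun Q p hp => (hB Q p hp).1) hBcard
  constructor
  · intro H
    have h1 := key (1 / 2) (by norm_num) (by
      filter_upwards [hSN] with Q hQ p hp
      have : (p : ℝ) ≤ ∑ p ∈ B Q, (p : ℝ) :=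
        Finset.single_le_sum (f := fun p : ℕ => (p : ℝ)) (fun _ _ => by positivity) hp
      linarith)
    have h2 := ((h1.sub (H (1 / 2) (by norm_num))).add_const (1 / 2)).const_mul 2
    norm_num at h2
    refine h2.congr fun Q => ?_
    ring
  · intro H Λ hΛ
    have h1 := key Λ hΛ (by
      have hev : ∀ᶠ Q in atTop, (∑ p ∈ B Q, (p : ℝ) ^ 2) / ((fareyPrimeSet P (B Q)).card : ℝ) ^ 2
          < 1 / Λ ^ 2 := H.eventually_lt_const (by positivity)
      filter_upwards [hev, hSN] with Q hQ hQ2 p hp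
      have hpp : (0 : ℝ) < p := by exact_mod_cast (hB Q p hp).1.pos
      have hs : (p : ℝ) ≤ ∑ p ∈ B Q, (p : ℝ) :=
        Finset.single_le_sum (f := fun p : ℕ => (p : ℝ)) (fun _ _ => by positivity) hp
      have hs2 : (p : ℝ) ^ 2 ≤ ∑ p ∈ B Q, (p : ℝ) ^ 2 :=
        Finset.single_le_sum (f := fun p : ℕ => (p : ℝ) ^ 2) (fun _ _ => by positivity) hp
      have hNpos : 0 < ((fareyPrimeSet P (B Q)).card : ℝ) := by linarith
      rw [div_lt_div_iff₀ (by positivity) (by positivity)] at hQ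
      refine abs_le_of_sq_le_sq' ?_ hNpos.le |>.2
      nlinarith [sq_nonneg Λ])
    have h2 := h1.add ((H.const_sub 1).const_mul Λ)
    simp only [sub_zero, mul_one, zero_add] at h2
    refine h2.congr fun Q => ?_
    ring
end

section
/- Let M_Q = {a/p : 1 ≤ a ≤ p ≤ Q, gcd(a, p) = 1, p prime} be the set of Farey fractions of order Q with prime denominators. Then the limiting pair correlation of the sequence (M_Q)_{Q ∈ ℕ} exists and is Poissonian: for every Λ > 0, lim_{Q→∞} S_{M_Q}(Λ) = Λ. -/
open Finset Filter

/-- The Farey fractions of order `Q` with prime denominators: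
`M_Q = {a/p : 1 ≤ a ≤ p ≤ Q, gcd(a,p) = 1, p prime}`. -/
def fareyPrimeDenom (Q : ℕ) : Finset ℚ :=
  ((Finset.Icc 1 Q).filter Nat.Prime).biUnion fun p =>
    ((Finset.Icc 1 p).filter fun a : ℕ => Nat.gcd a p = 1).image fun a : ℕ => (a : ℚ) / (p : ℚ)


def PR (Q : ℕ) : Finset ℕ := (Finset.Icc 1 Q).filter Nat.Prime

def NN (Q : ℕ) : ℕ := ∑ p ∈ PR Q, (p - 1)

lemma PR_card (Q : ℕ) : (PR Q).card = Nat.primeCounting Q := by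
  unfold PR
  rw [Nat.primeCounting, Nat.primeCounting', Nat.count_eq_card_filter_range]
  congr 1
  ext p
  simp only [Finset.mem_filter, Finset.mem_Icc, Finset.mem_range]
  constructor
  · rintro ⟨⟨_, h⟩, hp⟩; exact ⟨by omega, hp⟩
  · rintro ⟨h, hp⟩; exact ⟨⟨hp.one_le, by omega⟩, hp⟩

lemma pi_small (ε : ℝ) (hε : 0 < ε) : ∀ᶠ T : ℕ in atTop, ((PR T).card : ℝ) ≤ ε * T := by
  have h1 := (tendsto_natCast_atTop_atTop (R := ℝ)).eventually
    (Chebyshev.eventually_primeCounting_le (ε := 1) one_pos)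
  have h2 := (Real.tendsto_log_atTop.comp (tendsto_natCast_atTop_atTop (R := ℝ))).eventually_ge_atTop
    ((Real.log 4 + 1) / ε)
  have h4 : 0 < Real.log 4 := Real.log_pos (by norm_num)
  filter_upwards [h1, h2] with T h1 h2
  rw [PR_card]
  simp only [Nat.floor_natCast, Function.comp] at h1 h2
  have hl : 0 < Real.log T := lt_of_lt_of_le (by positivity) h2
  refine h1.trans ?_
  rw [div_le_iff₀ hl]
  rw [div_le_iff₀ hε] at h2
  nlinarith [mul_le_mul_of_nonneg_right h2 (Nat.cast_nonneg (α := ℝ) T)]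

lemma pi_large : ∀ᶠ Q : ℕ in atTop, (Q : ℝ) ≤ ((PR Q).card : ℝ) ^ 2 := by
  have h2 := (tendsto_natCast_atTop_atTop (R := ℝ)).eventually
    ((isLittleO_log_rpow_atTop (r := 1/2) (by norm_num)).bound (c := 1/8) (by norm_num))
  filter_upwards [h2, eventually_ge_atTop 16] with Q h2 hQ
  rw [PR_card]
  have hQ' : (16 : ℝ) ≤ Q := by exact_mod_cast hQ
  have h1 := Chebyshev.pi_ge Q
  have hl : 0 < Real.log Q := Real.log_pos (by linarith)
  have hs0 := Real.sqrt_nonneg (Q : ℝ)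
  have hss : √(Q:ℝ) * √Q = Q := Real.mul_self_sqrt (by linarith)
  rw [← Real.sqrt_eq_rpow, Real.norm_of_nonneg hl.le, Real.norm_of_nonneg hs0] at h2
  have h3 : Real.log (Q + 1) ≤ 2 * Real.log Q := by
    rw [← Real.log_rpow (by linarith)] 
    · apply Real.log_le_log (by linarith)
      norm_num
      nlinarith
  have h5 := Real.log_two_gt_d9
  have h6 : √(Q:ℝ) ≤ (Q * Real.log 2 - Real.log (Q + 1)) / Real.log Q := by
    rw [le_div_iff₀ hl]
    have : √(Q:ℝ) * Real.log Q ≤ √Q * (1/8 * √Q) := by gcongr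
    have : 4 ≤ √(Q:ℝ) := by
      rw [Real.le_sqrt' (by norm_num)]; linarith
    nlinarith
  have h7 := h6.trans h1
  nlinarith

lemma NN_ge (Q T : ℕ) : (T : ℝ) * ((PR Q).card - (PR T).card) ≤ NN Q := by
  have h1 : T * ((PR Q).filter (fun p => T < p)).card ≤ NN Q := by
    unfold NN
    calc _ = ∑ p ∈ (PR Q).filter (fun p => T < p), T := by simp [mul_comm]
      _ ≤ ∑ p ∈ (PR Q).filter (fun p => T < p), (p - 1) := by
        apply Finset.sum_le_sum
        intro p hp
        have := (Finset.mem_filter.1 hp).2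
        omega
      _ ≤ _ := Finset.sum_le_sum_of_subset (Finset.filter_subset _ _)
  have h2 : (PR Q).card ≤ ((PR Q).filter (fun p => T < p)).card + (PR T).card := by
    rw [← Finset.card_filter_add_card_filter_not (s := PR Q) (fun p => T < p)]
    gcongr
    intro p hp
    simp only [PR, Finset.mem_filter, Finset.mem_Icc] at hp ⊢
    exact ⟨⟨hp.1.1.1, by omega⟩, hp.1.2⟩
  have h1' : (T : ℝ) * ((PR Q).filter (fun p => T < p)).card ≤ NN Q := by exact_mod_cast h1
  have h2' : ((PR Q).card : ℝ) ≤ ((PR Q).filter (fun p => T < p)).card + (PR T).card := by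
    exact_mod_cast h2
  refine le_trans ?_ h1'
  gcongr
  linarith

lemma card_tendsto : Tendsto (fun Q => ((PR Q).card : ℝ)) atTop atTop := by
  have : Tendsto (fun Q => ((PR Q).card : ℝ) ^ 2) atTop atTop :=
    tendsto_atTop_mono' _ pi_large tendsto_natCast_atTop_atTop
  rw [tendsto_atTop] at this ⊢
  intro b
  filter_upwards [this (b ^ 2)] with Q h
  exact le_of_sq_le_sq h (by positivity) 

lemma card_sq_div : Tendsto (fun Q => ((PR Q).card : ℝ) ^ 2 / NN Q) atTop (nhds 0) := by
  rw [Metric.tendsto_nhds]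
  intro δ hδ
  obtain ⟨ε, hε, hεδ⟩ : ∃ ε : ℝ, 0 < ε ∧ 8 * ε < δ := ⟨δ / 16, by positivity, by linarith⟩
  have h1 : Tendsto (fun Q => ((PR Q).card : ℝ) / (2 * ε)) atTop atTop :=
    card_tendsto.atTop_div_const (by positivity)
  have h2 := (tendsto_nat_floor_atTop.comp h1).eventually (pi_small ε hε)
  filter_upwards [h2, h1.eventually_ge_atTop 2] with Q h2 h3
  simp only [Function.comp] at h2
  set n : ℝ := ((PR Q).card : ℝ)
  set T := ⌊n / (2 * ε)⌋₊
  have hT : (T : ℝ) ≤ n / (2 * ε) := Nat.floor_le (by linarith)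
  have hT' : n / (2 * ε) < T + 1 := Nat.lt_floor_add_one _
  have h4 := NN_ge Q T
  have hn : 0 < n := by
    rw [le_div_iff₀ (by positivity)] at h3
    nlinarith
  have h5 : ε * T ≤ n / 2 := by
    rw [le_div_iff₀ (by positivity)] at hT
    linarith
  have h6 : n / (4 * ε) ≤ T := by
    have : n / (2 * ε) = 2 * (n / (4 * ε)) := by field_simp; ring
    linarith
  have h7 : n / (4 * ε) * (n / 2) ≤ NN Q := by
    refine le_trans ?_ h4
    apply mul_le_mul h6 _ (by positivity) (by positivity)
    change n / 2 ≤ n - _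
    linarith
  have h8 : 0 < n / (4 * ε) * (n / 2) := by positivity
  have h9 : (0:ℝ) < NN Q := by linarith
  rw [Real.dist_eq, sub_zero, abs_of_nonneg (by positivity), div_lt_iff₀ h9]
  have : n ^ 2 = 8 * ε * (n / (4 * ε) * (n / 2)) := by field_simp; ring
  rw [this]
  nlinarith

lemma Q_div : Tendsto (fun Q : ℕ => (Q : ℝ) / NN Q) atTop (nhds 0) := by
  refine squeeze_zero' (Eventually.of_forall fun Q => by positivity) ?_ card_sq_div
  filter_upwards [pi_large] with Q h
  gcongr

lemma card_div : Tendsto (fun Q : ℕ => ((PR Q).card : ℝ) / NN Q) atTop (nhds 0) := by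
  refine squeeze_zero (fun Q => by positivity) (fun Q => ?_) Q_div
  gcongr
  calc (PR Q).card ≤ (Finset.Icc 1 Q).card := Finset.card_filter_le _ _
    _ = Q := by simp

lemma NN_tendsto : Tendsto (fun Q : ℕ => (NN Q : ℝ)) atTop atTop := by
  have h := Q_div.eventually_lt_const (show (0:ℝ) < 1 by norm_num)
  refine tendsto_atTop_mono' _ ?_ (tendsto_natCast_atTop_atTop (R := ℝ))
  have h' := card_tendsto.eventually_ge_atTop 2
  filter_upwards [h, h', eventually_ge_atTop 1] with Q h h' hQ
  rcases (Nat.cast_nonneg (α := ℝ) (NN Q)).eq_or_lt with h0 | h0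
  · exfalso
    have := NN_ge Q 1
    have h1 : (PR 1).card = 0 := by
      rw [PR_card]; simp
    rw [h1] at this
    push_cast at this
    linarith
  · rw [div_lt_one h0] at h; exact h.le

lemma A_eq (p : ℕ) (hp : p.Prime) :
    ((Finset.Icc 1 p).filter fun a : ℕ => Nat.gcd a p = 1) = Finset.Icc 1 (p - 1) := by
  ext a
  simp only [Finset.mem_filter, Finset.mem_Icc]
  have h2 := hp.two_le
  constructor
  · rintro ⟨⟨h1, h3⟩, h⟩
    refine ⟨h1, ?_⟩
    rcases eq_or_lt_of_le h3 with rfl | h4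
    · rw [Nat.gcd_self] at h; omega
    · omega
  · rintro ⟨h1, h3⟩
    refine ⟨⟨h1, by omega⟩, ?_⟩
    exact Nat.Coprime.symm ((Nat.Prime.coprime_iff_not_dvd hp).2
      (fun h => by have := Nat.le_of_dvd h1 h; omega))

lemma frac_ne {p q a b : ℕ} (hp : p.Prime) (hq : q.Prime) (ha : a ∈ Finset.Icc 1 (p - 1))
    (hpq : p ≠ q) : (a : ℚ) / p ≠ (b : ℚ) / q := by
  intro h
  have hp0 : (p : ℚ) ≠ 0 := by exact_mod_cast hp.ne_zero
  have hq0 : (q : ℚ) ≠ 0 := by exact_mod_cast hq.ne_zero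
  rw [div_eq_div_iff hp0 hq0] at h
  have h' : a * q = b * p := by exact_mod_cast h
  have hd : p ∣ a * q := ⟨b, by rw [h', mul_comm]⟩
  rw [Finset.mem_Icc] at ha
  rcases hp.dvd_mul.1 hd with h1 | h1
  · have := Nat.le_of_dvd ha.1 h1; omega
  · exact hpq ((Nat.prime_dvd_prime_iff_eq hp hq).1 h1)

lemma sumF {M : Type*} [AddCommMonoid M] (Q : ℕ) (f : ℚ → M) :
    ∑ x ∈ fareyPrimeDenom Q, f x = ∑ p ∈ PR Q, ∑ a ∈ Finset.Icc 1 (p - 1), f ((a : ℚ) / p) := by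
  unfold fareyPrimeDenom
  rw [Finset.sum_biUnion]
  · apply Finset.sum_congr rfl
    intro p hp
    have hp' : p.Prime := (Finset.mem_filter.1 hp).2
    rw [A_eq p hp', Finset.sum_image]
    intro a _ b _ h
    have hp0 : (p : ℚ) ≠ 0 := by exact_mod_cast hp'.ne_zero
    simpa [div_left_inj' hp0] using h
  · intro p hp q hq hpq
    have hp' : p.Prime := (Finset.mem_filter.1 hp).2
    have hq' : q.Prime := (Finset.mem_filter.1 hq).2
    simp only [Function.onFun]
    rw [A_eq p hp', A_eq q hq', Finset.disjoint_left]
    intro x hx hy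
    obtain ⟨a, ha, rfl⟩ := Finset.mem_image.1 hx
    obtain ⟨b, hb, hab⟩ := Finset.mem_image.1 hy
    exact frac_ne hp' hq' ha hpq hab.symm

lemma cardF (Q : ℕ) : (fareyPrimeDenom Q).card = NN Q := by
  rw [Finset.card_eq_sum_ones, sumF]
  simp [NN]

open scoped Classical in
noncomputable def cc (p q : ℕ) (N Λ : ℝ) : ℕ :=
  ((Finset.Icc 1 (p - 1) ×ˢ Finset.Icc 1 (q - 1)).filter (fun x : ℕ × ℕ =>
    (x.1 : ℚ) / p ≠ (x.2 : ℚ) / q ∧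
      ∃ k : ℤ, ((((x.1 : ℚ) / p : ℚ) : ℝ) - (((x.2 : ℚ) / q : ℚ) : ℝ) - (k : ℝ)) * N
        ∈ Set.Ioo 0 Λ)).card

lemma pairCorr_eq_s5 (Q : ℕ) (Λ : ℝ) : pairCorr (fareyPrimeDenom Q) Λ =
    (∑ p ∈ PR Q, ∑ q ∈ PR Q, (cc p q (NN Q) Λ : ℝ)) / NN Q := by
  classical
  unfold pairCorr
  rw [cardF]
  congr 1
  rw [Finset.card_filter, Finset.sum_product, sumF]
  push_cast
  apply Finset.sum_congr rfl
  intro p _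
  simp_rw [sumF]
  rw [Finset.sum_comm]
  apply Finset.sum_congr rfl
  intro q _
  unfold cc
  rw [Finset.card_filter, Finset.sum_product]
  push_cast
  rfl

lemma key_id {p q : ℕ} (hp : 0 < p) (hq : 0 < q) {N Λ : ℝ} (hN : 0 < N) (a b : ℕ) (k : ℤ) :
    ((((a : ℚ) / p : ℚ) : ℝ) - (((b : ℚ) / q : ℚ) : ℝ) - (k : ℝ)) * N ∈ Set.Ioo 0 Λ ↔
    0 < (a : ℤ) * q - b * p - k * (p * q) ∧
      (((a : ℤ) * q - b * p - k * (p * q) : ℤ) : ℝ) < Λ * p * q / N := by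
  have hp' : (0 : ℝ) < p := by exact_mod_cast hp
  have hq' : (0 : ℝ) < q := by exact_mod_cast hq
  have e : ((((a : ℚ) / p : ℚ) : ℝ) - (((b : ℚ) / q : ℚ) : ℝ) - (k : ℝ)) * N =
      (((a : ℤ) * q - b * p - k * (p * q) : ℤ) : ℝ) * (N / (p * q)) := by
    push_cast
    field_simp
  rw [e, Set.mem_Ioo]
  have h0 : 0 < N / (p * q) := by positivity
  rw [mul_pos_iff_of_pos_right h0, Int.cast_pos, ← lt_div_iff₀ h0]
  have : Λ / (N / (p * q)) = Λ * p * q / N := by field_simp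
  rw [this]

lemma cc_self {p Q : ℕ} (hp : 0 < p) (hpQ : p ≤ Q) {N Λ : ℝ} (hN : 0 < N) (hΛ : 0 < Λ)
    (h : Λ * Q ≤ N) : cc p p N Λ = 0 := by
  classical
  unfold cc
  rw [Finset.card_eq_zero, Finset.filter_eq_empty_iff]
  rintro ⟨a, b⟩ - ⟨-, k, hk⟩
  rw [key_id hp hp hN] at hk
  have hp' : (0 : ℝ) < p := by exact_mod_cast hp
  have hpQ' : (p : ℝ) ≤ Q := by exact_mod_cast hpQ
  obtain ⟨h1, h2⟩ := hk
  have e : (a : ℤ) * p - b * p - k * (p * p) = (a - b - k * p) * p := by ring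
  rw [e] at h1 h2
  have h3 : 0 < (a : ℤ) - b - k * p := pos_of_mul_pos_left h1 (by positivity)
  have h3' : (1 : ℝ) ≤ (((a : ℤ) - b - k * p : ℤ) : ℝ) := by exact_mod_cast h3
  rw [Int.cast_mul, lt_div_iff₀ hN, Int.cast_natCast] at h2
  have h4 : (p : ℝ) ≤ (((a : ℤ) - b - k * p : ℤ) : ℝ) * p := by nlinarith
  have h5 : Λ * p ≤ N := le_trans (by gcongr) h
  nlinarith

lemma cc_le {p q : ℕ} (hp : p.Prime) (hq : q.Prime) (hpq : p ≠ q) {N Λ : ℝ} (hN : 0 < N)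
    (hΛ : 0 < Λ) (h : Λ ≤ N) : (cc p q N Λ : ℝ) ≤ Λ * p * q / N := by
  classical
  set X := Λ * p * q / N with hX
  have hp' : (0 : ℝ) < p := by exact_mod_cast hp.pos
  have hq' : (0 : ℝ) < q := by exact_mod_cast hq.pos
  have hX0 : 0 < X := by positivity
  have hXpq : X ≤ p * q := by
    rw [hX, div_le_iff₀ hN]
    have : 0 < (p : ℝ) * q := by positivity
    nlinarith
  have hcard : cc p q N Λ ≤ (Finset.Ioo (0 : ℤ) ⌈X⌉).card := by
    unfold cc
    apply Finset.card_le_card_of_injOn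
      (fun x : ℕ × ℕ => ((x.1 : ℤ) * q - x.2 * p) % (p * q))
    · rintro ⟨a, b⟩ hab
      simp only [Finset.coe_filter, Set.mem_ofPred_eq] at hab
      obtain ⟨-, -, k, hk⟩ := hab
      rw [key_id hp.pos hq.pos hN] at hk
      have e : ((a : ℤ) * q - b * p) % (p * q) = (a : ℤ) * q - b * p - k * (p * q) := by
        have hlt : (a : ℤ) * q - b * p - k * (p * q) < p * q := by
          have := hk.2.trans_le hXpq
          exact_mod_cast this
        rw [← Int.emod_eq_of_lt hk.1.le hlt, Int.sub_mul_emod_self_right]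
      simp only [Finset.coe_Ioo, Set.mem_Ioo]
      rw [e, Int.lt_ceil]
      exact hk
    · rintro ⟨a, b⟩ hab ⟨a', b'⟩ hab' heq
      simp only [Finset.coe_filter, Set.mem_ofPred_eq, Finset.mem_product, Finset.mem_Icc] at hab hab'
      have hab := hab.1
      have hab' := hab'.1
      change ((a : ℤ) * q - b * p) % (p * q) = ((a' : ℤ) * q - b' * p) % (p * q) at heq
      obtain ⟨t, ht⟩ := Int.dvd_of_emod_eq_zero (Int.emod_eq_emod_iff_emod_sub_eq_zero.1 heq)
      have c1 : IsCoprime (p : ℤ) q := Nat.isCoprime_iff_coprime.2 ((Nat.coprime_primes hp hq).2 hpq)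
      have d1 : (p : ℤ) ∣ a - a' := by
        apply c1.dvd_of_dvd_mul_right
        exact ⟨b - b' + q * t, by linear_combination ht⟩
      have d2 : (q : ℤ) ∣ b - b' := by
        apply c1.symm.dvd_of_dvd_mul_right
        exact ⟨a - a' - p * t, by linear_combination -ht⟩
      have e1 := Int.eq_zero_of_abs_lt_dvd d1 (by rw [abs_lt]; omega)
      have e2 := Int.eq_zero_of_abs_lt_dvd d2 (by rw [abs_lt]; omega)
      simp only [Prod.mk.injEq]
      omega
  have h1 : ((Finset.Ioo (0 : ℤ) ⌈X⌉).card : ℝ) ≤ X := by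
    rw [Int.card_Ioo]
    have hc : 0 < ⌈X⌉ := Int.ceil_pos.2 hX0
    have e : (((⌈X⌉ - 0 - 1).toNat : ℤ) : ℝ) = ⌈X⌉ - 1 := by
      rw [Int.toNat_of_nonneg (by omega)]; push_cast; ring
    rw [Int.cast_natCast] at e
    rw [e]
    linarith [Int.ceil_lt_add_one X]
  exact le_trans (by exact_mod_cast hcard) h1

lemma mult_card (p : ℕ) (hp : 0 < p) (X : ℝ) (hX : 0 < X) :
    (((Finset.Ioo (0 : ℤ) ⌈X⌉).filter (fun m => (p : ℤ) ∣ m)).card : ℝ) ≤ X / p := by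
  have hp' : (0 : ℝ) < p := by exact_mod_cast hp
  have h : ((Finset.Ioo (0 : ℤ) ⌈X⌉).filter (fun m => (p : ℤ) ∣ m)).card
      ≤ (Finset.Ioc (0 : ℤ) ⌊X / p⌋).card := by
    apply Finset.card_le_card_of_injOn (fun m : ℤ => m / (p : ℤ))
    · intro m hm
      simp only [Finset.coe_filter, Set.mem_ofPred_eq, Finset.mem_Ioo, Int.lt_ceil] at hm
      obtain ⟨⟨h1, h2⟩, t, rfl⟩ := hm
      have hp0 : (p : ℤ) ≠ 0 := by omega
      simp only [Int.mul_ediv_cancel_left _ hp0, Finset.coe_Ioc, Set.mem_Ioc]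
      refine ⟨pos_of_mul_pos_right h1 (by positivity), ?_⟩
      rw [Int.le_floor, le_div_iff₀ hp']
      push_cast at h2
      linarith
    · intro m hm m' hm' e
      simp only [Finset.coe_filter, Set.mem_ofPred_eq] at hm hm'
      rw [← Int.ediv_mul_cancel hm.2, ← Int.ediv_mul_cancel hm'.2]
      simp only at e
      rw [e]
  have hf : 0 ≤ ⌊X / p⌋ := Int.floor_nonneg.2 (by positivity)
  have e : (((Finset.Ioc (0 : ℤ) ⌊X / p⌋).card : ℤ) : ℝ) = ⌊X / p⌋ := by
    rw [Int.card_Ioc, Int.toNat_of_nonneg (by omega)]; push_cast; ring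
  rw [Int.cast_natCast] at e
  calc _ ≤ ((Finset.Ioc (0 : ℤ) ⌊X / p⌋).card : ℝ) := by exact_mod_cast h
    _ ≤ _ := by rw [e]; exact Int.floor_le _

lemma cc_ge {p q : ℕ} (hp : p.Prime) (hq : q.Prime) (hpq : p ≠ q) {N Λ : ℝ} (hN : 0 < N)
    (hΛ : 0 < Λ) (h : Λ ≤ N) :
    Λ * p * q / N - 1 - Λ * p / N - Λ * q / N ≤ (cc p q N Λ : ℝ) := by
  classical
  set X := Λ * p * q / N with hX
  have hp' : (0 : ℝ) < p := by exact_mod_cast hp.pos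
  have hq' : (0 : ℝ) < q := by exact_mod_cast hq.pos
  have hX0 : 0 < X := by positivity
  have hXpq : X ≤ p * q := by
    rw [hX, div_le_iff₀ hN]
    have : 0 < (p : ℝ) * q := by positivity
    nlinarith
  have hcard : ((Finset.Ioo (0 : ℤ) ⌈X⌉).filter (fun m => ¬ (p : ℤ) ∣ m ∧ ¬ (q : ℤ) ∣ m)).card
      ≤ cc p q N Λ := by
    unfold cc
    apply Finset.card_le_card_of_surjOn
      (fun x : ℕ × ℕ => ((x.1 : ℤ) * q - x.2 * p) % (p * q))
    intro m hm
    simp only [Finset.coe_filter, Set.mem_ofPred_eq, Finset.mem_Ioo, Int.lt_ceil] at hm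
    obtain ⟨⟨h1, h2⟩, h3, h4⟩ := hm
    have c1 : IsCoprime (p : ℤ) q := Nat.isCoprime_iff_coprime.2 ((Nat.coprime_primes hp hq).2 hpq)
    obtain ⟨v, u, huv⟩ := c1
    have hpz : (0 : ℤ) < p := by exact_mod_cast hp.pos
    have hqz : (0 : ℤ) < q := by exact_mod_cast hq.pos
    have ha0 := Int.emod_nonneg (m * u) hpz.ne'
    have hb0 := Int.emod_nonneg (-(m * v)) hqz.ne'
    have ha1 := Int.emod_lt_of_pos (m * u) hpz
    have hb1 := Int.emod_lt_of_pos (-(m * v)) hqz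
    have ea := Int.emod_add_mul_ediv (m * u) p
    have eb := Int.emod_add_mul_ediv (-(m * v)) q
    set k1 := (m * u) / p
    set k2 := (-(m * v)) / q
    obtain ⟨a, ha⟩ := Int.eq_ofNat_of_zero_le ha0
    obtain ⟨b, hb⟩ := Int.eq_ofNat_of_zero_le hb0
    rw [ha] at ea ha1
    rw [hb] at eb hb1
    have hm : m = a * q - b * p - (k2 - k1) * (p * q) := by
      linear_combination (-m) * huv - q * ea + p * eb
    have ha2 : 1 ≤ a := by
      rcases Nat.eq_zero_or_pos a with rfl | h'
      · exact absurd ⟨-b - (k2 - k1) * q, by rw [hm]; push_cast; ring⟩ h3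
      · exact h'
    have hb2 : 1 ≤ b := by
      rcases Nat.eq_zero_or_pos b with rfl | h'
      · exact absurd ⟨a - (k2 - k1) * p, by rw [hm]; push_cast; ring⟩ h4
      · exact h'
    have hlt : m < p * q := by
      have := h2.trans_le hXpq
      exact_mod_cast this
    refine ⟨(a, b), ?_, ?_⟩
    · simp only [Finset.coe_filter, Set.mem_ofPred_eq, Finset.mem_product, Finset.mem_Icc]
      refine ⟨⟨⟨ha2, by omega⟩, hb2, by omega⟩, ?_, k2 - k1, ?_⟩
      · exact frac_ne hp hq (Finset.mem_Icc.2 ⟨ha2, by omega⟩) hpq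
      · rw [key_id hp.pos hq.pos hN, ← hm]
        exact ⟨h1, h2⟩
    · change ((a : ℤ) * q - b * p) % (p * q) = m
      rw [← Int.sub_mul_emod_self_right _ (k2 - k1), ← hm]
      exact Int.emod_eq_of_lt h1.le hlt
  have h1 : X - 1 ≤ ((Finset.Ioo (0 : ℤ) ⌈X⌉).card : ℝ) := by
    rw [Int.card_Ioo]
    have hc : 0 < ⌈X⌉ := Int.ceil_pos.2 hX0
    have e : (((⌈X⌉ - 0 - 1).toNat : ℤ) : ℝ) = ⌈X⌉ - 1 := by
      rw [Int.toNat_of_nonneg (by omega)]; push_cast; ring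
    rw [Int.cast_natCast] at e
    rw [e]
    linarith [Int.le_ceil X]
  have h2 : (Finset.Ioo (0 : ℤ) ⌈X⌉).card ≤
      ((Finset.Ioo (0 : ℤ) ⌈X⌉).filter (fun m => ¬ (p : ℤ) ∣ m ∧ ¬ (q : ℤ) ∣ m)).card +
      ((Finset.Ioo (0 : ℤ) ⌈X⌉).filter (fun m => (p : ℤ) ∣ m)).card +
      ((Finset.Ioo (0 : ℤ) ⌈X⌉).filter (fun m => (q : ℤ) ∣ m)).card := by
    refine le_trans (Finset.card_le_card ?_) ((Finset.card_union_le _ _).trans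
      (Nat.add_le_add_right (Finset.card_union_le _ _) _))
    intro m hm
    simp only [Finset.mem_union, Finset.mem_filter, hm, true_and]
    tauto
  have h3 := mult_card p hp.pos X hX0
  have h4 := mult_card q hq.pos X hX0
  have e3 : X / p = Λ * q / N := by rw [hX]; field_simp
  have e4 : X / q = Λ * p / N := by rw [hX]; field_simp
  have h2' : ((Finset.Ioo (0 : ℤ) ⌈X⌉).card : ℝ) ≤
      ((Finset.Ioo (0 : ℤ) ⌈X⌉).filter (fun m => ¬ (p : ℤ) ∣ m ∧ ¬ (q : ℤ) ∣ m)).card +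
      ((Finset.Ioo (0 : ℤ) ⌈X⌉).filter (fun m => (p : ℤ) ∣ m)).card +
      ((Finset.Ioo (0 : ℤ) ⌈X⌉).filter (fun m => (q : ℤ) ∣ m)).card := by exact_mod_cast h2
  have hcard' : (((Finset.Ioo (0 : ℤ) ⌈X⌉).filter
      (fun m => ¬ (p : ℤ) ∣ m ∧ ¬ (q : ℤ) ∣ m)).card : ℝ) ≤ cc p q N Λ := by exact_mod_cast hcard
  linarith

lemma sum_PR (Q : ℕ) : ∑ p ∈ PR Q, (p : ℝ) = NN Q + (PR Q).card := by
  unfold NN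
  rw [Finset.card_eq_sum_ones, Nat.cast_sum, Nat.cast_sum, ← Finset.sum_add_distrib]
  apply Finset.sum_congr rfl
  intro p hp
  have hp' : p.Prime := (Finset.mem_filter.1 hp).2
  rw [Nat.cast_sub hp'.one_le]
  simp

lemma PR_mem {Q p : ℕ} (hp : p ∈ PR Q) : p.Prime ∧ p ≤ Q :=
  ⟨(Finset.mem_filter.1 hp).2, (Finset.mem_Icc.1 (Finset.mem_filter.1 hp).1).2⟩

lemma upper (Q : ℕ) (Λ : ℝ) (hΛ : 0 < Λ) (hN : (0:ℝ) < NN Q) (h : Λ ≤ NN Q)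
    (h' : Λ * Q ≤ NN Q) :
    pairCorr (fareyPrimeDenom Q) Λ ≤ Λ * (1 + (PR Q).card / NN Q) ^ 2 := by
  rw [pairCorr_eq_s5, div_le_iff₀ hN]
  calc _ ≤ ∑ p ∈ PR Q, ∑ q ∈ PR Q, Λ / NN Q * ((p : ℝ) * q) := by
        apply Finset.sum_le_sum; intro p hp
        apply Finset.sum_le_sum; intro q hq
        by_cases hpq : p = q
        · subst hpq
          rw [cc_self (PR_mem hp).1.pos (PR_mem hp).2 hN hΛ h']
          push_cast; positivity
        · refine (cc_le (PR_mem hp).1 (PR_mem hq).1 hpq hN hΛ h).trans (le_of_eq ?_)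
          ring
    _ = Λ / NN Q * ((NN Q + (PR Q).card) * (NN Q + (PR Q).card)) := by
        rw [← sum_PR, Finset.sum_mul_sum]
        simp_rw [Finset.mul_sum]
    _ = _ := by field_simp

lemma lower (Q : ℕ) (Λ : ℝ) (hΛ : 0 < Λ) (hN : (0:ℝ) < NN Q) (h : Λ ≤ NN Q) :
    Λ * (1 + (PR Q).card / NN Q) ^ 2 - (PR Q).card ^ 2 / NN Q
      - 2 * Λ * ((PR Q).card / NN Q) * (1 + (PR Q).card / NN Q)
      - Λ * (Q / NN Q) * (1 + (PR Q).card / NN Q) ≤ pairCorr (fareyPrimeDenom Q) Λ := by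
  rw [pairCorr_eq_s5, le_div_iff₀ hN]
  calc _ = Λ / NN Q * ((NN Q + (PR Q).card) * (NN Q + (PR Q).card)) - (PR Q).card ^ 2
        - 2 * (Λ / NN Q) * ((PR Q).card * (NN Q + (PR Q).card))
        - Λ / NN Q * Q * (NN Q + (PR Q).card) := by field_simp
    _ = ∑ p ∈ PR Q, ∑ q ∈ PR Q, (Λ / NN Q * ((p : ℝ) * q) - 1 - Λ / NN Q * p - Λ / NN Q * q
          - if p = q then Λ / NN Q * Q * p else 0) := by
        rw [← sum_PR]
        simp only [Finset.sum_sub_distrib, Finset.sum_ite_eq, Finset.sum_const, nsmul_eq_mul]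
        rw [Finset.sum_mul_sum, Finset.sum_ite_mem, Finset.inter_self]
        simp only [← Finset.mul_sum]
        ring
    _ ≤ _ := by
        apply Finset.sum_le_sum; intro p hp
        apply Finset.sum_le_sum; intro q hq
        have hpp : (0:ℝ) < p := by exact_mod_cast (PR_mem hp).1.pos
        by_cases hpq : p = q
        · subst hpq
          have : (p : ℝ) ≤ Q := by exact_mod_cast (PR_mem hp).2
          have h1 : (0 : ℝ) ≤ cc p p (NN Q) Λ := by positivity
          have h2 : Λ / NN Q * (p * p) ≤ Λ / NN Q * Q * p := by
            rw [mul_assoc]; gcongr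
          have h3 : 0 ≤ Λ / NN Q * p := by positivity
          rw [if_pos rfl]
          linarith
        · have := cc_ge (PR_mem hp).1 (PR_mem hq).1 hpq hN hΛ h
          rw [if_neg hpq]
          refine le_trans (le_of_eq ?_) this
          ring

/-- **Corollary (Xiong et al.).** The limiting pair correlation of the Farey fractions with
prime denominators exists and is Poissonian. -/
theorem pairCorr_fareyPrimeDenom_poissonian :
    ∀ Λ : ℝ, 0 < Λ →
      Tendsto (fun Q : ℕ => pairCorr (fareyPrimeDenom Q) Λ) atTop (nhds Λ) := by
  intro Λ hΛ
  have hn := card_div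
  have hQ := Q_div
  have hs := card_sq_div
  have e1 : ∀ᶠ Q : ℕ in atTop, Λ * Q ≤ NN Q := by
    filter_upwards [hQ.eventually_lt_const (show (0:ℝ) < 1 / Λ by positivity),
      NN_tendsto.eventually_gt_atTop 0] with Q h h0
    rw [div_lt_div_iff₀ h0 hΛ] at h
    linarith
  have l1 : Tendsto (fun Q : ℕ => Λ * (1 + ((PR Q).card : ℝ) / NN Q) ^ 2) atTop (nhds Λ) := by
    have := ((hn.const_add 1).pow 2).const_mul Λ
    simpa using this
  have l2 : Tendsto (fun Q : ℕ => Λ * (1 + ((PR Q).card : ℝ) / NN Q) ^ 2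
      - ((PR Q).card : ℝ) ^ 2 / NN Q
      - 2 * Λ * (((PR Q).card : ℝ) / NN Q) * (1 + ((PR Q).card : ℝ) / NN Q)
      - Λ * ((Q : ℝ) / NN Q) * (1 + ((PR Q).card : ℝ) / NN Q)) atTop (nhds Λ) := by
    have := ((l1.sub hs).sub ((hn.const_mul (2 * Λ)).mul (hn.const_add 1))).sub
      ((hQ.const_mul Λ).mul (hn.const_add 1))
    simpa using this
  refine tendsto_of_tendsto_of_tendsto_of_le_of_le' l2 l1 ?_ ?_
  · filter_upwards [NN_tendsto.eventually_gt_atTop 0, NN_tendsto.eventually_ge_atTop Λ]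
      with Q h0 h
    exact lower Q Λ hΛ h0 h
  · filter_upwards [NN_tendsto.eventually_gt_atTop 0, NN_tendsto.eventually_ge_atTop Λ, e1]
      with Q h0 h h'
    exact upper Q Λ hΛ h0 h h'
end

section
/- Let ν ≥ 1 and let P(X) = c_ν X^ν + ⋯ + c_1 X ∈ ℤ[X] be a polynomial with nonzero discriminant. Let q ≥ 2 and l be positive integers with gcd(q, l) = 1, and for Q ≥ 1 set S(Q; q, l) = #{a/n ∈ F_{Q,P} : n ≡ l (mod q)} = #{(a,n) : 1 ≤ a ≤ n ≤ Q, gcd(P(a), n) = 1, n ≡ l (mod q)}. Then for every ε > 0, S(Q; q, l) = (Q²/(2φ(q))) · ∏_{p | q} (1 − 1/p) · ∏_{p ∤ q} (1 − f_P(p)/p²) + O(Q^{3/2 + ε}), with implied constant depending on q, P, and ε. -/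
open Finset Filter

/-- `S(Q; q, l)`: the number of polynomial Farey fractions `a/n ∈ F_{Q,P}` with
`n ≡ l (mod q)`. -/
def SQl (P : Polynomial ℤ) (Q q l : ℕ) : ℕ :=
  ((Finset.Icc 1 Q ×ˢ Finset.Icc 1 Q).filter
    (fun x => x.1 ≤ x.2 ∧ Int.gcd (P.eval (x.1 : ℤ)) (x.2 : ℤ) = 1 ∧ x.2 % q = l % q)).card


lemma dvd_eval_periodic (P : Polynomial ℤ) (m : ℕ) :
    Function.Periodic (fun d : ℕ => (m : ℤ) ∣ P.eval (d : ℤ)) m := by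
  intro d
  have h := Polynomial.sub_dvd_eval_sub ((d + m : ℕ) : ℤ) (d : ℤ) P
  have h2 : (m : ℤ) ∣ P.eval ((d + m : ℕ) : ℤ) - P.eval (d : ℤ) := by
    refine dvd_trans ?_ h
    push_cast; simp
  exact propext (by simpa using dvd_iff_dvd_of_dvd_sub h2)

lemma count_block (P : Polynomial ℤ) (m n : ℕ) :
    ((Finset.Ioc n (n + m)).filter (fun d : ℕ => (m : ℤ) ∣ P.eval (d : ℤ))).card
      = Nat.count (fun d : ℕ => (m : ℤ) ∣ P.eval (d : ℤ)) m := by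
  rw [← Nat.filter_Ico_card_eq_of_periodic (n+1) m _ (dvd_eval_periodic P m)]
  congr 1
  ext x
  simp only [Finset.mem_filter, Finset.mem_Ioc, Finset.mem_Ico]
  constructor <;> rintro ⟨h, h'⟩ <;> exact ⟨by omega, h'⟩

lemma fP_eq_count (P : Polynomial ℤ) (m : ℕ) :
    fP P m = Nat.count (fun d : ℕ => (m : ℤ) ∣ P.eval (d : ℤ)) m := by
  rw [← count_block P m 0, fP]
  congr 1
  ext x
  simp only [Finset.mem_filter, Finset.mem_Ioc, Finset.mem_Icc]
  constructor <;> rintro ⟨h, h'⟩ <;> exact ⟨by omega, h'⟩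

lemma count_mul (P : Polynomial ℤ) (m k : ℕ) :
    ((Finset.Ioc 0 (m * k)).filter (fun d : ℕ => (m : ℤ) ∣ P.eval (d : ℤ))).card
      = k * fP P m := by
  induction k with
  | zero => simp
  | succ k ih =>
    have : Finset.Ioc 0 (m * (k+1)) = Finset.Ioc 0 (m*k) ∪ Finset.Ioc (m*k) (m*k+m) := by
      rw [Finset.Ioc_union_Ioc_eq_Ioc (by omega) (by omega)]; ring_nf
    rw [this, Finset.filter_union, Finset.card_union_of_disjoint, ih, count_block, ← fP_eq_count]
    · ring
    · apply Finset.disjoint_filter_filter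
      rw [Finset.disjoint_left]
      intro x hx hy
      simp only [Finset.mem_Ioc] at hx hy
      omega

lemma fP_eq_card (P : Polynomial ℤ) (m : ℕ) [NeZero m] :
    fP P m = (Finset.univ.filter
      (fun x : ZMod m => (P.map (Int.castRingHom (ZMod m))).eval x = 0)).card := by
  have key : ∀ d : ℕ, (P.map (Int.castRingHom (ZMod m))).eval (d : ZMod m) = 0 ↔
      (m : ℤ) ∣ P.eval (d : ℤ) := by
    intro d
    rw [← ZMod.intCast_zmod_eq_zero_iff_dvd]
    have := Polynomial.eval_intCast_map (Int.castRingHom (ZMod m)) P (d : ℤ)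
    simp only [Int.cast_natCast, eq_intCast] at this
    rw [this]
  rw [fP_eq_count, Nat.count_eq_card_filter_range]
  refine Finset.card_bij (fun d _ => (d : ZMod m)) ?_ ?_ ?_
  · intro d hd
    simp only [Finset.mem_filter, Finset.mem_univ, true_and] at hd ⊢
    exact (key d).2 hd.2
  · intro a ha b hb h
    simp only [Finset.mem_filter, Finset.mem_range] at ha hb
    rw [ZMod.natCast_eq_natCast_iff'] at h
    rwa [Nat.mod_eq_of_lt ha.1, Nat.mod_eq_of_lt hb.1] at h
  · intro x hx
    simp only [Finset.mem_filter, Finset.mem_univ, true_and] at hx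
    refine ⟨x.val, ?_, ZMod.natCast_zmod_val x⟩
    simp only [Finset.mem_filter, Finset.mem_range]
    exact ⟨ZMod.val_lt x, (key _).1 (by rwa [ZMod.natCast_zmod_val])⟩

lemma fP_zero (P : Polynomial ℤ) : fP P 0 = 0 := by simp [fP]
lemma fP_one (P : Polynomial ℤ) : fP P 1 = 1 := by simp [fP]

lemma fP_mul (P : Polynomial ℤ) {m n : ℕ} (h : m.Coprime n) :
    fP P (m * n) = fP P m * fP P n := by
  rcases Nat.eq_zero_or_pos m with rfl | hm
  · simp [fP_zero]
  rcases Nat.eq_zero_or_pos n with rfl | hn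
  · simp [fP_zero]
  have : NeZero m := ⟨hm.ne'⟩
  have : NeZero n := ⟨hn.ne'⟩
  rw [fP_eq_card, fP_eq_card, fP_eq_card, ← Finset.card_product]
  have ev : ∀ x : ZMod (m*n), ZMod.chineseRemainder h
      ((P.map (Int.castRingHom (ZMod (m*n)))).eval x) =
      ((P.map (Int.castRingHom (ZMod m))).eval (ZMod.chineseRemainder h x).1,
       (P.map (Int.castRingHom (ZMod n))).eval (ZMod.chineseRemainder h x).2) := by
    intro x
    simp only [Polynomial.eval_map]
    have e1 := Polynomial.hom_eval₂ P (Int.castRingHom (ZMod (m*n)))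
      ((RingHom.fst (ZMod m) (ZMod n)).comp (ZMod.chineseRemainder h).toRingHom) x
    have e2 := Polynomial.hom_eval₂ P (Int.castRingHom (ZMod (m*n)))
      ((RingHom.snd (ZMod m) (ZMod n)).comp (ZMod.chineseRemainder h).toRingHom) x
    rw [RingHom.ext_int (RingHom.comp _ (Int.castRingHom (ZMod (m*n)))) (Int.castRingHom _)] at e1 e2
    exact Prod.ext e1 e2
  refine Finset.card_bij (fun x _ => ZMod.chineseRemainder h x) ?_ ?_ ?_
  · intro x hx
    simp only [Finset.mem_filter, Finset.mem_univ, true_and, Finset.mem_product] at hx ⊢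
    have := ev x
    rw [hx, map_zero] at this
    exact ⟨(congrArg Prod.fst this).symm, (congrArg Prod.snd this).symm⟩
  · intro a _ b _ hab
    exact (ZMod.chineseRemainder h).injective hab
  · intro y hy
    refine ⟨(ZMod.chineseRemainder h).symm y, ?_, by simp⟩
    simp only [Finset.mem_filter, Finset.mem_univ, true_and, Finset.mem_product] at hy ⊢
    apply (ZMod.chineseRemainder h).injective
    rw [ev, map_zero]
    simp [hy.1, hy.2]

lemma fP_prime_le (P : Polynomial ℤ) {p : ℕ} (hp : p.Prime)
    (h : P.leadingCoeff.natAbs < p) (hP : P ≠ 0) : fP P p ≤ P.natDegree := by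
  have := Fact.mk hp
  rw [fP_eq_card]
  have hne : P.map (Int.castRingHom (ZMod p)) ≠ 0 := by
    intro h0
    have := congrArg (fun R => Polynomial.coeff R P.natDegree) h0
    simp only [Polynomial.coeff_map, Polynomial.coeff_zero, eq_intCast] at this
    rw [ZMod.intCast_zmod_eq_zero_iff_dvd, Int.natCast_dvd] at this
    have h2 := Nat.le_of_dvd (Int.natAbs_pos.2 (by simpa using hP)) this
    exact absurd h (not_lt.2 h2)
  calc _ ≤ (P.map (Int.castRingHom (ZMod p))).roots.toFinset.card := by
        apply Finset.card_le_card
        intro x hx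
        simp only [Finset.mem_filter, Finset.mem_univ, true_and] at hx
        rw [Multiset.mem_toFinset, Polynomial.mem_roots hne]
        exact hx
    _ ≤ _ := Multiset.toFinset_card_le _
    _ ≤ _ := Polynomial.card_roots' _
    _ ≤ _ := Polynomial.natDegree_map_le

lemma fP_le (P : Polynomial ℤ) (m : ℕ) : fP P m ≤ m := by
  unfold fP
  exact (Finset.card_filter_le _ _).trans (by simp)

noncomputable def fA (P : Polynomial ℤ) : ArithmeticFunction ℕ := ⟨fP P, fP_zero P⟩

lemma fA_mult (P : Polynomial ℤ) : (fA P).IsMultiplicative :=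
  ⟨fP_one P, fun {_ _} h => fP_mul P h⟩

lemma fP_bound (P : Polynomial ℤ) (hP : P ≠ 0) :
    ∃ K : ℝ, 0 < K ∧ ∀ d : ℕ, Squarefree d → (fP P d : ℝ) ≤ K * √(d : ℝ) := by
  set B := max (P.leadingCoeff.natAbs + 1) (P.natDegree ^ 2) with hB
  refine ⟨((∏ p ∈ Finset.Icc 1 B, p : ℕ) : ℝ), ?_, ?_⟩
  · have : 0 < ∏ p ∈ Finset.Icc 1 B, p :=
      Finset.prod_pos (fun p hp => (Finset.mem_Icc.1 hp).1)
    exact_mod_cast this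
  intro d hd
  have hfd : fP P d = ∏ p ∈ d.primeFactors, fP P p := by
    have := (fA_mult P).map_prod_of_subset_primeFactors d _ subset_rfl
    rw [Nat.prod_primeFactors_of_squarefree hd] at this
    exact this
  have hsd : √(d : ℝ) = ∏ p ∈ d.primeFactors, √(p : ℝ) := by
    conv_lhs => rw [← Nat.prod_primeFactors_of_squarefree hd]
    push_cast
    exact Real.sqrt_prod _ (fun _ _ => by positivity)
  have h1 : (fP P d : ℝ) ≤
      (∏ p ∈ d.primeFactors, ((if p < B then p else 1 : ℕ) : ℝ)) * √(d : ℝ) := by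
    rw [hfd, hsd, ← Finset.prod_mul_distrib]
    push_cast
    apply Finset.prod_le_prod (fun _ _ => by positivity)
    intro p hp
    have hpp := Nat.prime_of_mem_primeFactors hp
    have h1p : (1 : ℝ) ≤ p := by exact_mod_cast hpp.one_lt.le
    split_ifs with hlt
    · have : (fP P p : ℝ) ≤ p := by exact_mod_cast fP_le P p
      have h1s : (1 : ℝ) ≤ √(p : ℝ) := by rw [Real.one_le_sqrt]; exact h1p
      push_cast
      nlinarith
    · rw [not_lt] at hlt
      have ha : P.leadingCoeff.natAbs < p := by
        have := le_max_left (P.leadingCoeff.natAbs + 1) (P.natDegree ^ 2); omega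
      have hb : P.natDegree ^ 2 ≤ p := by
        have := le_max_right (P.leadingCoeff.natAbs + 1) (P.natDegree ^ 2); omega
      have hc := fP_prime_le P hpp ha hP
      push_cast
      rw [one_mul]
      apply Real.le_sqrt_of_sq_le
      have : fP P p ^ 2 ≤ p := le_trans (Nat.pow_le_pow_left hc 2) hb
      exact_mod_cast this
  refine h1.trans ?_
  gcongr
  rw [← Nat.cast_prod, Nat.cast_le, Finset.prod_ite, Finset.prod_const_one, mul_one]
  apply Finset.prod_le_prod_of_subset_of_one_le'
  · intro p hp
    simp only [Finset.mem_filter, Finset.mem_Icc] at hp ⊢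
    exact ⟨(Nat.prime_of_mem_primeFactors hp.1).one_lt.le, hp.2.le⟩
  · intro p hp _
    exact (Finset.mem_Icc.1 hp).1

/-- sum of `m ≤ M`, `m ≡ r (mod q)` -/
def Tsum (q r M : ℕ) : ℕ := ∑ m ∈ (Finset.Ioc 0 M).filter (fun m => m % q = r % q), m

lemma block_card (q r M : ℕ) (hq : 0 < q) :
    ((Finset.Ioc M (M + q)).filter (fun m => m % q = r % q)).card = 1 := by
  have hper : Function.Periodic (fun m => m ≡ r [MOD q]) q := by
    intro m; simp [Nat.ModEq]
  have h := Nat.filter_Ico_card_eq_of_periodic (M+1) q (fun m => m ≡ r [MOD q]) hper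
  rw [Nat.count_modEq_card _ hq] at h
  simp only [Nat.div_self hq, Nat.mod_self, Nat.not_lt_zero, if_false, add_zero] at h
  have hset : (Finset.Ioc M (M + q)).filter (fun m => m % q = r % q) =
      (Finset.Ico (M + 1) (M + 1 + q)).filter (fun m => m ≡ r [MOD q]) := by
    ext x
    rw [Finset.mem_filter, Finset.mem_filter, Finset.mem_Ioc, Finset.mem_Ico]
    constructor <;> rintro ⟨h, h'⟩ <;> exact ⟨by omega, h'⟩
  rw [hset, h]

lemma Tsum_succ (q r M : ℕ) (hq : 0 < q) :
    Tsum q r M + M ≤ Tsum q r (M + q) ∧ Tsum q r (M + q) ≤ Tsum q r M + (M + q) := by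
  have e : Tsum q r (M + q) = Tsum q r M +
      ∑ m ∈ (Finset.Ioc M (M + q)).filter (fun m => m % q = r % q), m := by
    unfold Tsum
    rw [← Finset.Ioc_union_Ioc_eq_Ioc (Nat.zero_le M) (by omega : M ≤ M + q),
      Finset.filter_union, Finset.sum_union]
    apply Finset.disjoint_filter_filter
    rw [Finset.disjoint_left]
    intro x hx hy
    simp only [Finset.mem_Ioc] at hx hy
    omega
  obtain ⟨a, ha⟩ := Finset.card_eq_one.1 (block_card q r M hq)
  have : a ∈ (Finset.Ioc M (M + q)).filter (fun m => m % q = r % q) := by rw [ha]; simp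
  simp only [Finset.mem_filter, Finset.mem_Ioc] at this
  rw [ha, Finset.sum_singleton] at e
  omega

lemma Tsum_approx (q r : ℕ) (hq : 0 < q) (M : ℕ) :
    |(Tsum q r M : ℝ) - (M : ℝ) ^ 2 / (2 * q)| ≤ (M : ℝ) := by
  have hq' : (0 : ℝ) < q := by exact_mod_cast hq
  induction M using Nat.strong_induction_on with
  | _ M ih =>
  rcases lt_or_ge M q with h | h
  · have h1 : Tsum q r M ≤ M := by
      unfold Tsum
      have hc : ((Finset.Ioc 0 M).filter (fun m => m % q = r % q)).card ≤ 1 := by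
        rw [← block_card q r 0 hq]
        apply Finset.card_le_card
        apply Finset.filter_subset_filter
        apply Finset.Ioc_subset_Ioc le_rfl (by omega)
      calc _ ≤ _ := Finset.sum_le_card_nsmul _ _ M (fun x hx => by
              simp only [Finset.mem_filter, Finset.mem_Ioc] at hx; omega)
        _ ≤ _ := by rw [smul_eq_mul]; nlinarith
    have h1' : (Tsum q r M : ℝ) ≤ M := by exact_mod_cast h1
    have h0 : (0 : ℝ) ≤ Tsum q r M := by positivity
    have hM : (M : ℝ) ≤ q := by exact_mod_cast h.le
    have h2 : (M : ℝ) ^ 2 / (2 * q) ≤ M := by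
      rw [div_le_iff₀ (by positivity)]
      nlinarith [(Nat.cast_nonneg M : (0 : ℝ) ≤ M)]
    have h3 : 0 ≤ (M : ℝ) ^ 2 / (2 * q) := by positivity
    rw [abs_le]; constructor <;> linarith
  · obtain ⟨N, rfl⟩ : ∃ N, M = N + q := ⟨M - q, by omega⟩
    have := ih N (by omega)
    obtain ⟨h1, h2⟩ := Tsum_succ q r N hq
    have h1' : (Tsum q r N : ℝ) + N ≤ Tsum q r (N + q) := by exact_mod_cast h1
    have h2' : (Tsum q r (N + q) : ℝ) ≤ Tsum q r N + (N + q) := by exact_mod_cast h2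
    have e : ((N + q : ℕ) : ℝ) ^ 2 / (2 * q) = (N : ℝ) ^ 2 / (2 * q) + N + q / 2 := by
      push_cast; field_simp; ring
    rw [e]
    rw [abs_le] at this ⊢
    push_cast
    constructor <;> linarith [this.1, this.2]

lemma Tsum_approx' (q r : ℕ) (hq : 2 ≤ q) (Q d : ℕ) (hd : 0 < d) :
    |(Tsum q r (Q / d) : ℝ) - ((Q : ℝ) / d) ^ 2 / (2 * q)| ≤ 2 * ((Q : ℝ) / d) := by
  have h := Tsum_approx q r (by omega) (Q / d)
  set M := Q / d
  have hd' : (0 : ℝ) < d := by exact_mod_cast hd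
  have h1 : (M : ℝ) ≤ (Q : ℝ) / d := Nat.cast_div_le
  have h2 : (Q : ℝ) / d ≤ M + 1 := by
    rw [div_le_iff₀ hd']
    have : Q ≤ (M + 1) * d := by
      have := Nat.lt_div_mul_add (a := Q) hd
      change Q < M * d + d at this
      nlinarith
    exact_mod_cast this
  set x := (Q : ℝ) / d
  have hM : (0 : ℝ) ≤ M := by positivity
  have hx : 0 ≤ x := hM.trans h1
  have hq' : (2 : ℝ) ≤ q := by exact_mod_cast hq
  have h3 : x ^ 2 / (2 * q) ≤ (M : ℝ) ^ 2 / (2 * q) + x := by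
    rw [div_add' _ _ _ (by positivity)]
    gcongr
    nlinarith
  have h4 : (M : ℝ) ^ 2 / (2 * q) ≤ x ^ 2 / (2 * q) := by gcongr
  rw [abs_le] at h ⊢
  constructor <;> linarith [h.1, h.2]

lemma sum_inv_sqrt (Q : ℕ) : ∑ d ∈ Finset.Ioc 0 Q, √(d : ℝ) / d ≤ 2 * √(Q : ℝ) := by
  induction Q with
  | zero => simp
  | succ n ih =>
    rw [Finset.sum_Ioc_succ_top (Nat.zero_le n)]
    have ha : 0 ≤ √(n : ℝ) := Real.sqrt_nonneg _
    have hb : 0 < √((n + 1 : ℕ) : ℝ) := Real.sqrt_pos.2 (by positivity)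
    have ha2 : √(n : ℝ) ^ 2 = n := Real.sq_sqrt (by positivity)
    have hb2 : √((n + 1 : ℕ) : ℝ) ^ 2 = n + 1 := by rw [Real.sq_sqrt (by positivity)]; simp
    have hab : √(n : ℝ) ≤ √((n + 1 : ℕ) : ℝ) := Real.sqrt_le_sqrt (by push_cast; linarith)
    have e : (((n + 1 : ℕ) : ℝ)) = √((n + 1 : ℕ) : ℝ) ^ 2 := by rw [hb2]; simp
    have : √((n + 1 : ℕ) : ℝ) / ((n + 1 : ℕ) : ℝ) ≤ 2 * √((n + 1 : ℕ) : ℝ) - 2 * √(n : ℝ) := by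
      rw [div_le_iff₀ (by positivity)]
      conv_rhs => rw [e]
      set a := √(n : ℝ)
      set b := √((n + 1 : ℕ) : ℝ)
      rw [show √(b^2) = b from Real.sqrt_sq hb.le]
      have h1 : (b - a) * (b + a) = 1 := by nlinarith
      have h2 : 1 ≤ (b - a) * (2 * b) := by nlinarith
      nlinarith
    linarith

lemma tail_sum (Q N : ℕ) (hQ : 0 < Q) (hN : Q ≤ N) :
    ∑ d ∈ Finset.Ioc Q N, √(d : ℝ) / (d : ℝ) ^ 2 ≤ 2 / √(Q : ℝ) - 2 / √(N : ℝ) := by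
  induction N, hN using Nat.le_induction with
  | base => simp
  | succ n hn ih =>
    rw [Finset.sum_Ioc_succ_top hn]
    have ha : 0 < √(n : ℝ) := Real.sqrt_pos.2 (by have : 0 < n := by omega
                                                  exact_mod_cast this)
    have hb : 0 < √((n + 1 : ℕ) : ℝ) := Real.sqrt_pos.2 (by positivity)
    have ha2 : √(n : ℝ) ^ 2 = n := Real.sq_sqrt (by positivity)
    have hb2 : √((n + 1 : ℕ) : ℝ) ^ 2 = n + 1 := by rw [Real.sq_sqrt (by positivity)]; simp
    have hab : √(n : ℝ) ≤ √((n + 1 : ℕ) : ℝ) := Real.sqrt_le_sqrt (by push_cast; linarith)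
    have e : (((n + 1 : ℕ) : ℝ)) = √((n + 1 : ℕ) : ℝ) ^ 2 := by rw [hb2]; simp
    have : √((n + 1 : ℕ) : ℝ) / ((n + 1 : ℕ) : ℝ) ^ 2 ≤ 2 / √(n : ℝ) - 2 / √((n + 1 : ℕ) : ℝ) := by
      generalize hbb : √((n + 1 : ℕ) : ℝ) = b at *
      rw [e]
      generalize √(n : ℝ) = a at *
      have h1 : (b - a) * (b + a) = 1 := by nlinarith
      have h2 : 1 ≤ (b - a) * (2 * b) := by nlinarith
      rw [div_sub_div _ _ ha.ne' hb.ne', div_le_div_iff₀ (by positivity) (by positivity)]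
      have h3 : a * b ≤ b ^ 2 := by nlinarith
      have h4 : b * (a * b) ≤ b * b ^ 2 := by gcongr
      have h5 : b ^ 3 * 1 ≤ b ^ 3 * ((b - a) * (2 * b)) := by gcongr
      nlinarith
    linarith

lemma moebius_indicator (g : ℕ) :
    ∑ d ∈ g.divisors, ArithmeticFunction.moebius d = if g = 1 then 1 else 0 := by
  have h := congrArg (fun f => f g) ArithmeticFunction.moebius_mul_coe_zeta
  simp only [ArithmeticFunction.mul_zeta_apply, ArithmeticFunction.coe_mul_zeta_apply] at h
  rw [h, ArithmeticFunction.one_apply]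

lemma coprime_count (P : Polynomial ℤ) (n : ℕ) (hn : 0 < n) :
    (((Finset.Ioc 0 n).filter (fun a : ℕ => Int.gcd (P.eval (a : ℤ)) (n : ℤ) = 1)).card : ℤ) =
      ∑ d ∈ n.divisors, ArithmeticFunction.moebius d * (fP P d * (n / d : ℕ)) := by
  have h1 : ∀ a : ℕ, (if Int.gcd (P.eval (a : ℤ)) (n : ℤ) = 1 then (1 : ℤ) else 0) =
      ∑ d ∈ n.divisors, if (d : ℤ) ∣ P.eval (a : ℤ) then ArithmeticFunction.moebius d else 0 := by
    intro a
    rw [← moebius_indicator, ← Finset.sum_filter]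
    apply Finset.sum_congr _ (fun _ _ => rfl)
    ext d
    simp only [Nat.mem_divisors, Finset.mem_filter]
    have : Int.gcd (P.eval (a : ℤ)) (n : ℤ) ≠ 0 := by
      intro h; rw [Int.gcd_eq_zero_iff] at h; omega
    have h2 : d ∣ Int.gcd (P.eval (a : ℤ)) (n : ℤ) ↔ (d : ℤ) ∣ P.eval (a : ℤ) ∧ d ∣ n := by
      rw [Int.dvd_gcd_iff, Int.natCast_dvd_natCast]
    rw [h2]
    constructor
    · rintro ⟨⟨h, h'⟩, _⟩; exact ⟨⟨h', hn.ne'⟩, h⟩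
    · rintro ⟨⟨h, h'⟩, h3⟩; exact ⟨⟨h3, h⟩, this⟩
  rw [Finset.card_filter]
  push_cast
  rw [Finset.sum_congr rfl (fun a _ => h1 a), Finset.sum_comm]
  apply Finset.sum_congr rfl
  intro d hd
  have hdn := Nat.dvd_of_mem_divisors hd
  have hc := count_mul P d (n / d)
  rw [Nat.mul_div_cancel' hdn] at hc
  rw [← Finset.sum_filter, Finset.sum_const, hc, nsmul_eq_mul]
  push_cast
  ring

lemma SQl_eq_sum (P : Polynomial ℤ) (Q q l : ℕ) :
    (SQl P Q q l : ℤ) = ∑ n ∈ (Finset.Ioc 0 Q).filter (fun n => n % q = l % q),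
      (((Finset.Ioc 0 n).filter (fun a : ℕ => Int.gcd (P.eval (a : ℤ)) (n : ℤ) = 1)).card : ℤ) := by
  rw [← Nat.cast_sum, Nat.cast_inj, ← Finset.card_sigma]
  unfold SQl
  refine Finset.card_bij (fun x _ => ⟨x.2, x.1⟩) ?_ ?_ ?_
  · rintro ⟨a, n⟩ h
    simp only [Finset.mem_filter, Finset.mem_product, Finset.mem_Icc, Finset.mem_sigma,
      Finset.mem_Ioc] at h ⊢
    refine ⟨⟨by omega, h.2.2.2⟩, by omega, h.2.2.1⟩
  · rintro ⟨a, n⟩ _ ⟨b, m⟩ _ h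
    simp only [Sigma.mk.injEq, heq_eq_eq] at h
    rw [h.1, h.2]
  · rintro ⟨n, a⟩ h
    simp only [Finset.mem_filter, Finset.mem_sigma, Finset.mem_Ioc] at h
    refine ⟨(a, n), ?_, rfl⟩
    simp only [Finset.mem_filter, Finset.mem_product, Finset.mem_Icc]
    refine ⟨by omega, by omega, h.2.2, h.1.2⟩

lemma SQl_eq (P : Polynomial ℤ) (Q q l : ℕ) :
    (SQl P Q q l : ℤ) = ∑ d ∈ Finset.Ioc 0 Q, ArithmeticFunction.moebius d * fP P d *
      ((∑ m ∈ (Finset.Ioc 0 (Q / d)).filter (fun m => d * m % q = l % q), m : ℕ) : ℤ) := by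
  rw [SQl_eq_sum]
  have h1 : ∀ n ∈ (Finset.Ioc 0 Q).filter (fun n => n % q = l % q),
      (((Finset.Ioc 0 n).filter (fun a : ℕ => Int.gcd (P.eval (a : ℤ)) (n : ℤ) = 1)).card : ℤ) =
      ∑ d ∈ Finset.Ioc 0 Q, if d ∣ n then
        ArithmeticFunction.moebius d * (fP P d * (n / d : ℕ)) else 0 := by
    intro n hn
    simp only [Finset.mem_filter, Finset.mem_Ioc] at hn
    rw [coprime_count P n hn.1.1, ← Finset.sum_filter]
    apply Finset.sum_congr _ (fun _ _ => rfl)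
    ext d
    simp only [Nat.mem_divisors, Finset.mem_filter, Finset.mem_Ioc]
    constructor
    · rintro ⟨h, _⟩
      have := Nat.le_of_dvd hn.1.1 h
      have := Nat.pos_of_dvd_of_pos h hn.1.1
      exact ⟨by omega, h⟩
    · rintro ⟨_, h⟩; exact ⟨h, by omega⟩
  rw [Finset.sum_congr rfl h1, Finset.sum_comm]
  apply Finset.sum_congr rfl
  intro d hd
  have hd0 : 0 < d := (Finset.mem_Ioc.1 hd).1
  rw [← Finset.sum_filter, Nat.cast_sum, Finset.mul_sum]
  symm
  refine Finset.sum_bij (fun m _ => d * m) ?_ ?_ ?_ ?_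
  · intro m hm
    simp only [Finset.mem_filter, Finset.mem_Ioc] at hm ⊢
    refine ⟨⟨⟨Nat.mul_pos hd0 hm.1.1, ?_⟩, hm.2⟩, dvd_mul_right _ _⟩
    have := (Nat.le_div_iff_mul_le hd0).1 hm.1.2
    rwa [mul_comm]
  · intro a _ b _ h
    exact Nat.eq_of_mul_eq_mul_left hd0 h
  · intro n hn
    simp only [Finset.mem_filter, Finset.mem_Ioc] at hn
    obtain ⟨⟨⟨h0, hQ⟩, hl⟩, m, rfl⟩ := hn
    refine ⟨m, ?_, rfl⟩
    simp only [Finset.mem_filter, Finset.mem_Ioc]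
    refine ⟨⟨Nat.pos_of_mul_pos_left h0, ?_⟩, hl⟩
    rw [Nat.le_div_iff_mul_le hd0, mul_comm]; exact hQ
  · intro m _
    rw [Nat.mul_div_cancel_left _ hd0]
    ring

/-- the coefficients -/
noncomputable def hc (P : Polynomial ℤ) (q d : ℕ) : ℝ :=
  if d.Coprime q then (ArithmeticFunction.moebius d : ℝ) * fP P d else 0

lemma inner_sum_cases (q l d M : ℕ) (hq : 2 ≤ q) (hql : Nat.gcd q l = 1) :
    (d.Coprime q → ∃ r, ∑ m ∈ (Finset.Ioc 0 M).filter (fun m => d * m % q = l % q), m =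
      Tsum q r M) ∧ (¬ d.Coprime q →
      ∑ m ∈ (Finset.Ioc 0 M).filter (fun m => d * m % q = l % q), m = 0) := by
  constructor
  · intro h
    obtain ⟨u, _, hu⟩ := Nat.exists_mul_mod_eq_one_of_coprime h hq
    have hu' : d * u ≡ 1 [MOD q] := by
      rw [Nat.ModEq, hu, Nat.mod_eq_of_lt hq]
    refine ⟨u * l, ?_⟩
    unfold Tsum
    apply Finset.sum_congr _ (fun _ _ => rfl)
    apply Finset.filter_congr
    intro m _
    change d * m ≡ l [MOD q] ↔ m ≡ u * l [MOD q]
    constructor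
    · intro hm
      have e1 := hm.mul_left u
      have e2 := hu'.mul_right m
      rw [one_mul] at e2
      refine e2.symm.trans ?_
      rw [show d * u * m = u * (d * m) by ring]
      exact e1
    · intro hm
      have e1 := hm.mul_left d
      have e2 := hu'.mul_right l
      rw [one_mul] at e2
      refine e1.trans ?_
      rw [show d * (u * l) = d * u * l by ring]
      exact e2
  · intro h
    rw [Finset.filter_false_of_mem, Finset.sum_empty]
    intro m _ hm
    apply h
    have hm' : d * m ≡ l [MOD q] := hm
    have hg := hm'.gcd_eq
    rw [Nat.gcd_comm l q, hql] at hg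
    exact Nat.Coprime.coprime_mul_right hg

lemma SQl_main (P : Polynomial ℤ) (Q q l : ℕ) (hq : 2 ≤ q) (hql : Nat.gcd q l = 1) (K : ℝ)
    (hK : ∀ d, |hc P q d| ≤ K * √(d : ℝ)) :
    |(SQl P Q q l : ℝ) - (Q : ℝ) ^ 2 / (2 * q) * ∑ d ∈ Finset.Ioc 0 Q, hc P q d / (d : ℝ) ^ 2|
      ≤ 4 * K * Q * √(Q : ℝ) := by
  have hK0 : 0 ≤ K := by
    have := (abs_nonneg _).trans (hK 1); simpa using this
  have h1 : (SQl P Q q l : ℝ) = ∑ d ∈ Finset.Ioc 0 Q, (ArithmeticFunction.moebius d : ℝ) * fP P d *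
      ((∑ m ∈ (Finset.Ioc 0 (Q / d)).filter (fun m => d * m % q = l % q), m : ℕ) : ℝ) := by
    have := congrArg (fun z : ℤ => (z : ℝ)) (SQl_eq P Q q l)
    push_cast at this ⊢
    exact this
  rw [h1, Finset.mul_sum, ← Finset.sum_sub_distrib]
  refine (Finset.abs_sum_le_sum_abs _ _).trans ?_
  have h2 : ∀ d ∈ Finset.Ioc 0 Q, |(ArithmeticFunction.moebius d : ℝ) * fP P d *
      ((∑ m ∈ (Finset.Ioc 0 (Q / d)).filter (fun m => d * m % q = l % q), m : ℕ) : ℝ) -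
      (Q : ℝ) ^ 2 / (2 * q) * (hc P q d / (d : ℝ) ^ 2)| ≤ 2 * K * Q * (√(d : ℝ) / d) := by
    intro d hd
    have hd0 : 0 < d := (Finset.mem_Ioc.1 hd).1
    have hin := inner_sum_cases q l d (Q / d) hq hql
    by_cases hco : d.Coprime q
    · obtain ⟨r, hr⟩ := hin.1 hco
      have hh : hc P q d = (ArithmeticFunction.moebius d : ℝ) * fP P d := by
        unfold hc; rw [if_pos hco]
      rw [hr, ← hh, show hc P q d * (Tsum q r (Q / d) : ℝ) -
        (Q : ℝ) ^ 2 / (2 * q) * (hc P q d / (d : ℝ) ^ 2) =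
        hc P q d * ((Tsum q r (Q / d) : ℝ) - ((Q : ℝ) / d) ^ 2 / (2 * q)) by ring, abs_mul]
      calc _ ≤ (K * √(d : ℝ)) * (2 * ((Q : ℝ) / d)) := by
            gcongr
            · exact hK d
            · exact Tsum_approx' q r hq Q d hd0
        _ = _ := by ring
    · rw [hin.2 hco]
      unfold hc
      rw [if_neg hco]
      simp only [Nat.cast_zero, mul_zero, zero_div, sub_zero, abs_zero]
      positivity
  refine (Finset.sum_le_sum h2).trans ?_
  rw [← Finset.mul_sum]
  have := mul_le_mul_of_nonneg_left (sum_inv_sqrt Q) (by positivity : 0 ≤ 2 * K * (Q : ℝ))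
  linarith

lemma hc_bound (P : Polynomial ℤ) (hP : P ≠ 0) (q : ℕ) :
    ∃ K : ℝ, 0 < K ∧ ∀ d, |hc P q d| ≤ K * √(d : ℝ) := by
  obtain ⟨K, hK, h⟩ := fP_bound P hP
  refine ⟨K, hK, fun d => ?_⟩
  unfold hc
  by_cases hs : Squarefree d
  · split_ifs
    · rw [abs_mul]
      have h1 : |(ArithmeticFunction.moebius d : ℝ)| ≤ 1 := by
        have := ArithmeticFunction.abs_moebius_le_one (n := d)
        exact_mod_cast this
      rw [Nat.abs_cast]
      calc _ ≤ 1 * (fP P d : ℝ) := by gcongr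
        _ ≤ _ := by rw [one_mul]; exact h d hs
    · simp; positivity
  · rw [ArithmeticFunction.moebius_eq_zero_of_not_squarefree hs]
    simp; positivity

lemma hc_summable (P : Polynomial ℤ) (q : ℕ) (K : ℝ)
    (hK : ∀ d, |hc P q d| ≤ K * √(d : ℝ)) :
    Summable (fun d : ℕ => ‖hc P q d / (d : ℝ) ^ 2‖) := by
  have hs : Summable (fun d : ℕ => K * (d : ℝ) ^ (-(3/2) : ℝ)) :=
    (Real.summable_nat_rpow.2 (by norm_num)).mul_left K
  refine Summable.of_nonneg_of_le (fun _ => norm_nonneg _) (fun d => ?_) hs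
  rcases Nat.eq_zero_or_pos d with rfl | hd
  · have : hc P q 0 = 0 := by simp [hc]
    rw [this]; simp
  · have hd' : (0 : ℝ) < d := by exact_mod_cast hd
    rw [Real.norm_eq_abs, abs_div, abs_of_pos (by positivity : (0 : ℝ) < (d : ℝ) ^ 2),
      div_le_iff₀ (by positivity)]
    refine (hK d).trans (le_of_eq ?_)
    rw [mul_assoc, Real.sqrt_eq_rpow, ← Real.rpow_natCast (d : ℝ) 2, ← Real.rpow_add hd']
    norm_num

lemma hc_prod (P : Polynomial ℤ) (q : ℕ) (K : ℝ)
    (hK : ∀ d, |hc P q d| ≤ K * √(d : ℝ)) :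
    (∏' p : Nat.Primes,
      if (p : ℕ) ∣ q then (1 : ℝ) else 1 - (fP P (p : ℕ) : ℝ) / ((p : ℕ) : ℝ) ^ 2) =
    ∑' d : ℕ, hc P q d / (d : ℝ) ^ 2 := by
  have h := EulerProduct.eulerProduct_hasProd (f := fun d : ℕ => hc P q d / (d : ℝ) ^ 2)
    (by simp [hc, fP_one]) (by
      intro m n hmn
      have hm := ArithmeticFunction.isMultiplicative_moebius.map_mul_of_coprime hmn
      have hi : (m * n).Coprime q ↔ m.Coprime q ∧ n.Coprime q := Nat.coprime_mul_iff_left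
      unfold hc
      by_cases h1 : m.Coprime q
      · by_cases h2 : n.Coprime q
        · rw [if_pos (hi.2 ⟨h1, h2⟩), if_pos h1, if_pos h2, hm, fP_mul P hmn]
          push_cast
          ring
        · rw [if_neg (fun h => h2 (hi.1 h).2), if_neg h2]; simp
      · rw [if_neg (fun h => h1 (hi.1 h).1), if_neg h1]; simp) (hc_summable P q K hK) (by simp)
  rw [← h.tprod_eq]
  apply tprod_congr
  intro p
  have hp := p.2
  rw [tsum_eq_sum (s := Finset.range 2)]
  · rw [Finset.sum_range_succ, Finset.sum_range_one]
    have hpq : (p : ℕ).Coprime q ↔ ¬ (p : ℕ) ∣ q := hp.coprime_iff_not_dvd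
    by_cases hd : (p : ℕ) ∣ q
    · simp [hc, fP_one, hpq, hd]
    · simp [hc, fP_one, hpq, hd, ArithmeticFunction.moebius_apply_prime hp]
      ring
  · intro e he
    rw [Finset.mem_range, not_lt] at he
    have : ArithmeticFunction.moebius ((p : ℕ) ^ e) = 0 := by
      rw [ArithmeticFunction.moebius_apply_prime_pow hp (by omega), if_neg (by omega)]
    simp [hc, this]

lemma hc_tail (P : Polynomial ℤ) (q : ℕ) (K : ℝ) (hK0 : 0 < K)
    (hK : ∀ d, |hc P q d| ≤ K * √(d : ℝ)) (Q : ℕ) (hQ : 0 < Q) :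
    |(∑ d ∈ Finset.Ioc 0 Q, hc P q d / (d : ℝ) ^ 2) - ∑' d : ℕ, hc P q d / (d : ℝ) ^ 2|
      ≤ K * (2 / √(Q : ℝ)) := by
  have hs := (hc_summable P q K hK).of_norm
  have ht := hs.hasSum.tendsto_sum_nat
  have ht2 := (tendsto_const_nhds (x := ∑ d ∈ Finset.Ioc 0 Q, hc P q d / (d : ℝ) ^ 2)).sub
    (ht.comp (tendsto_add_atTop_nat 1))
  refine le_of_tendsto ht2.abs ?_
  filter_upwards [eventually_ge_atTop Q] with N hN
  have e : ∑ d ∈ Finset.range (N + 1), hc P q d / (d : ℝ) ^ 2 =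
      ∑ d ∈ Finset.Ioc 0 N, hc P q d / (d : ℝ) ^ 2 := by
    symm
    apply Finset.sum_subset
    · intro x hx
      rw [Finset.mem_Ioc] at hx
      rw [Finset.mem_range]; omega
    · intro x hx hx'
      rw [Finset.mem_range] at hx
      rw [Finset.mem_Ioc] at hx'
      obtain rfl : x = 0 := by omega
      simp
  simp only [Function.comp_apply]
  rw [e, ← Finset.sum_Ioc_consecutive _ (Nat.zero_le Q) hN, sub_add_cancel_left, abs_neg]
  refine (Finset.abs_sum_le_sum_abs _ _).trans ?_
  have : ∀ d ∈ Finset.Ioc Q N, |hc P q d / (d : ℝ) ^ 2| ≤ K * (√(d : ℝ) / (d : ℝ) ^ 2) := by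
    intro d _
    rw [abs_div, abs_of_nonneg (by positivity : (0 : ℝ) ≤ (d : ℝ) ^ 2), ← mul_div_assoc]
    gcongr
    exact hK d
  refine (Finset.sum_le_sum this).trans ?_
  rw [← Finset.mul_sum]
  gcongr
  refine (tail_sum Q N hQ hN).trans ?_
  have : 0 ≤ 2 / √(N : ℝ) := by positivity
  linarith

/-- **Proposition.** For `gcd(q,l) = 1`,
`S(Q;q,l) = Q²/(2φ(q)) ∏_{p∣q}(1-1/p) ∏_{p∤q}(1-f_P(p)/p²) + O(Q^{3/2+ε})`. -/
theorem SQl_asymptotic (ν : ℕ) (hν : 1 ≤ ν) (c : ℕ → ℤ) (hcν : c ν ≠ 0)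
    (P : Polynomial ℤ)
    (hP : P = ∑ i ∈ Finset.Icc 1 ν, Polynomial.C (c i) * Polynomial.X ^ i)
    (hdisc : (P.map (Int.castRingHom ℚ)).Separable)
    (q l : ℕ) (hq : 2 ≤ q) (hl : 1 ≤ l) (hql : Nat.gcd q l = 1) :
    ∀ ε : ℝ, 0 < ε → ∃ C : ℝ, 0 < C ∧ ∀ Q : ℕ, 1 ≤ Q →
      |(SQl P Q q l : ℝ) -
          (Q : ℝ) ^ 2 / (2 * (Nat.totient q : ℝ)) *
            (∏ p ∈ q.primeFactors, (1 - 1 / (p : ℝ))) *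
            (∏' p : Nat.Primes,
              if (p : ℕ) ∣ q then 1 else 1 - (fP P (p : ℕ) : ℝ) / ((p : ℕ) : ℝ) ^ 2)| ≤
        C * (Q : ℝ) ^ ((3 : ℝ) / 2 + ε) := by
  intro ε hε
  have hP0 : P ≠ 0 := by
    rintro rfl
    exact hdisc.ne_zero (by simp)
  obtain ⟨K, hK0, hK⟩ := hc_bound P hP0 q
  refine ⟨6 * K, by positivity, fun Q hQ => ?_⟩
  rw [hc_prod P q K hK]
  have hq0 : (0 : ℝ) < q := by exact_mod_cast (by omega : 0 < q)
  have hφ0 : (0 : ℝ) < Nat.totient q := by exact_mod_cast Nat.totient_pos.2 (by omega)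
  have hφ : (Nat.totient q : ℝ) = q * ∏ p ∈ q.primeFactors, (1 - 1 / (p : ℝ)) := by
    have := congrArg (fun x : ℚ => (x : ℝ)) (Nat.totient_eq_mul_prod_factors q)
    push_cast at this
    simpa only [one_div] using this
  have hconst : (Q : ℝ) ^ 2 / (2 * (Nat.totient q : ℝ)) *
      (∏ p ∈ q.primeFactors, (1 - 1 / (p : ℝ))) = (Q : ℝ) ^ 2 / (2 * q) := by
    have e : (∏ p ∈ q.primeFactors, (1 - 1 / (p : ℝ))) = (Nat.totient q : ℝ) / q := by
      rw [hφ]; field_simp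
    rw [e]; field_simp
  rw [hconst]
  have h1 := SQl_main P Q q l hq hql K hK
  have h2 := hc_tail P q K hK0 hK Q hQ
  set A := ∑ d ∈ Finset.Ioc 0 Q, hc P q d / (d : ℝ) ^ 2
  set T := ∑' d : ℕ, hc P q d / (d : ℝ) ^ 2
  have hQ1 : (1 : ℝ) ≤ Q := by exact_mod_cast hQ
  have hq2 : (2 : ℝ) ≤ q := by exact_mod_cast hq
  have hs0 : 0 < √(Q : ℝ) := Real.sqrt_pos.2 (by linarith)
  have hs2 : √(Q : ℝ) ^ 2 = Q := Real.sq_sqrt (by linarith)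
  have h3 : |(Q : ℝ) ^ 2 / (2 * q) * A - (Q : ℝ) ^ 2 / (2 * q) * T| ≤ 2 * K * Q * √(Q : ℝ) := by
    rw [← mul_sub, abs_mul, abs_of_nonneg (by positivity)]
    calc _ ≤ (Q : ℝ) ^ 2 / 1 * (K * (2 / √(Q : ℝ))) := by
          gcongr
          linarith
      _ = 2 * K * Q * (Q / √(Q : ℝ)) := by ring
      _ = _ := by rw [Real.div_sqrt]
  have h4 : (Q : ℝ) * √(Q : ℝ) ≤ (Q : ℝ) ^ ((3 : ℝ) / 2 + ε) := by
    have : (Q : ℝ) * √(Q : ℝ) = (Q : ℝ) ^ ((3 : ℝ) / 2) := by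
      rw [Real.sqrt_eq_rpow]
      nth_rewrite 1 [← Real.rpow_one (Q : ℝ)]
      rw [← Real.rpow_add (by linarith)]
      norm_num
    rw [this]
    exact Real.rpow_le_rpow_of_exponent_le hQ1 (by linarith)
  calc _ ≤ _ := abs_sub_le _ ((Q : ℝ) ^ 2 / (2 * q) * A) _
    _ ≤ 6 * K * (Q * √(Q : ℝ)) := by linarith
    _ ≤ _ := by gcongr
end

section
/- Let ν ≥ 2 be an integer, let P(X) = c_ν X^ν + ⋯ + c_1 X ∈ ℤ[X] be a polynomial with nonzero discriminant, and let r be an integer. Then for every positive integer Q, Σ_{γ ∈ F_{Q,P}} e(rγ) = Σ_{q ≤ Q, q | r} q · Σ_{d ≤ Q/q} μ(d) · Σ_{1 ≤ a ≤ d, P(a) ≡ 0 (mod d)} e(ra/(qd)), where the outer sum is over positive integers q ≤ Q dividing r and the middle sum is over positive integers d ≤ Q/q. -/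
open Finset Filter

/-- `e(x) = exp(2πix)`. -/
noncomputable def eFun (x : ℝ) : ℂ := Complex.exp (2 * Real.pi * Complex.I * x)

lemma aux_eFun_add (x y : ℝ) : eFun (x + y) = eFun x * eFun y := by
  unfold eFun
  rw [← Complex.exp_add]
  congr 1
  push_cast
  ring

lemma aux_geom (r : ℤ) (q : ℕ) (hq : 1 ≤ q) :
    ∑ k ∈ Finset.range q, eFun ((r : ℝ) * (k : ℝ) / (q : ℝ)) =
      if (q : ℤ) ∣ r then (q : ℂ) else 0 := by
  have hq0 : (q : ℂ) ≠ 0 := by exact_mod_cast (by omega : q ≠ 0)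
  have hpi : (2 * Real.pi * Complex.I : ℂ) ≠ 0 := Complex.two_pi_I_ne_zero
  have hpow : ∀ k : ℕ, eFun ((r : ℝ) * (k : ℝ) / (q : ℝ)) = (eFun ((r : ℝ) / (q : ℝ))) ^ k := by
    intro k
    unfold eFun
    rw [← Complex.exp_nat_mul]
    congr 1
    push_cast
    ring
  have hone : eFun ((r : ℝ) / (q : ℝ)) = 1 ↔ (q : ℤ) ∣ r := by
    unfold eFun
    rw [Complex.exp_eq_one_iff]
    constructor
    · rintro ⟨n, hn⟩
      refine ⟨n, ?_⟩
      push_cast at hn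
      rw [mul_comm (n : ℂ)] at hn
      have h2 := mul_left_cancel₀ hpi hn
      rw [div_eq_iff hq0] at h2
      have h3 : (r : ℂ) = ((q * n : ℤ) : ℂ) := by push_cast; rw [h2]; ring
      exact_mod_cast h3
    · rintro ⟨n, rfl⟩
      refine ⟨n, ?_⟩
      push_cast
      field_simp
  simp_rw [hpow]
  split_ifs with h
  · rw [hone.2 h]; simp
  · have hne : eFun ((r : ℝ) / (q : ℝ)) ≠ 1 := fun h' => h (hone.1 h')
    rw [geom_sum_eq hne, ← hpow]
    have : eFun ((r : ℝ) * (q : ℝ) / (q : ℝ)) = 1 := by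
      have hq1 : (q : ℝ) ≠ 0 := by exact_mod_cast (by omega : q ≠ 0)
      rw [mul_div_assoc, div_self hq1, mul_one]
      unfold eFun
      rw [Complex.exp_eq_one_iff]
      exact ⟨r, by push_cast; ring⟩
    rw [this]; simp

lemma aux_range_mul (f : ℕ → ℂ) (q d : ℕ) :
    ∑ i ∈ Finset.range (q * d), f i =
      ∑ k ∈ Finset.range q, ∑ b ∈ Finset.range d, f (k * d + b) := by
  induction q with
  | zero => simp
  | succ q ih =>
    rw [Finset.sum_range_succ, ← ih, Nat.succ_mul, Finset.sum_range_add]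

lemma aux_Icc (f : ℕ → ℂ) (n : ℕ) :
    ∑ i ∈ Finset.Icc 1 n, f i = ∑ i ∈ Finset.range n, f (i + 1) := by
  have : Finset.Icc 1 n = Finset.Ico 1 (n + 1) := by ext; simp
  rw [this, Finset.sum_Ico_eq_sum_range]
  simp [add_comm]

lemma aux_inner (P : Polynomial ℤ) (r : ℤ) (q d : ℕ) (hq : 1 ≤ q) (hd : 1 ≤ d) :
    ∑ a ∈ (Finset.Icc 1 (q * d)).filter (fun a : ℕ => (d : ℤ) ∣ P.eval (a : ℤ)),
        eFun ((r : ℝ) * (a : ℝ) / ((q * d : ℕ) : ℝ)) =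
      if (q : ℤ) ∣ r then (q : ℂ) *
        ∑ a ∈ (Finset.Icc 1 d).filter (fun a : ℕ => (d : ℤ) ∣ P.eval (a : ℤ)),
          eFun ((r : ℝ) * (a : ℝ) / ((q : ℝ) * (d : ℝ))) else 0 := by
  have hq1 : (q : ℝ) ≠ 0 := by exact_mod_cast (by omega : q ≠ 0)
  have hd1 : (d : ℝ) ≠ 0 := by exact_mod_cast (by omega : d ≠ 0)
  rw [Finset.sum_filter, aux_Icc, aux_range_mul]
  have key : ∀ k b : ℕ, (if (d : ℤ) ∣ P.eval ((k * d + b + 1 : ℕ) : ℤ) then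
      eFun ((r : ℝ) * ((k * d + b + 1 : ℕ) : ℝ) / ((q * d : ℕ) : ℝ)) else 0) =
      eFun ((r : ℝ) * (k : ℝ) / (q : ℝ)) *
      (if (d : ℤ) ∣ P.eval ((b + 1 : ℕ) : ℤ) then
        eFun ((r : ℝ) * ((b + 1 : ℕ) : ℝ) / ((q : ℝ) * (d : ℝ))) else 0) := by
    intro k b
    have h1 : (d : ℤ) ∣ P.eval ((k * d + b + 1 : ℕ) : ℤ) - P.eval ((b + 1 : ℕ) : ℤ) := by
      refine dvd_trans ?_ (Polynomial.sub_dvd_eval_sub _ _ P)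
      exact ⟨k, by push_cast; ring⟩
    have h2 := dvd_iff_dvd_of_dvd_sub h1
    by_cases h : (d : ℤ) ∣ P.eval ((b + 1 : ℕ) : ℤ)
    · rw [if_pos h, if_pos (h2.2 h), ← aux_eFun_add]
      congr 1
      push_cast
      field_simp
      ring
    · rw [if_neg h, if_neg (fun h' => h (h2.1 h')), mul_zero]
  simp_rw [key, ← Finset.mul_sum]
  rw [← Finset.sum_mul, aux_geom r q hq, Finset.sum_filter, aux_Icc]
  split_ifs <;> simp

lemma aux_moebius (m : ℤ) (n : ℕ) (hn : 1 ≤ n) :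
    ∑ d ∈ n.divisors, (if (d : ℤ) ∣ m then (ArithmeticFunction.moebius d : ℂ) else 0) =
      if Int.gcd m n = 1 then 1 else 0 := by
  rw [← Finset.sum_filter]
  have h0 : Int.gcd m n ≠ 0 := by
    rw [Ne, Int.gcd_eq_zero_iff]; omega
  have : n.divisors.filter (fun d : ℕ => (d : ℤ) ∣ m) = (Int.gcd m n).divisors := by
    ext d
    simp only [Finset.mem_filter, Nat.mem_divisors]
    constructor
    · rintro ⟨⟨h1, _⟩, h2⟩
      exact ⟨Int.dvd_gcd h2 (by exact_mod_cast h1), h0⟩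
    · rintro ⟨h, _⟩
      have h' : (d : ℤ) ∣ (Int.gcd m n : ℤ) := by exact_mod_cast h
      refine ⟨⟨?_, by omega⟩, h'.trans (Int.gcd_dvd_left ..)⟩
      exact_mod_cast h'.trans (Int.gcd_dvd_right ..)
  rw [this]
  have h3 := congrArg (fun f => f (Int.gcd m n)) ArithmeticFunction.moebius_mul_coe_zeta
  simp only [ArithmeticFunction.mul_zeta_apply, ArithmeticFunction.coe_mul_zeta_apply,
    ArithmeticFunction.one_apply] at h3
  have h4 := congrArg (fun z : ℤ => (z : ℂ)) h3
  push_cast at h4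
  simpa using h4

lemma aux_reindex (F : ℕ → ℕ → ℂ) (Q : ℕ) :
    ∑ n ∈ Finset.Icc 1 Q, ∑ d ∈ n.divisors, F n d =
      ∑ q ∈ Finset.Icc 1 Q, ∑ d ∈ Finset.Icc 1 (Q / q), F (q * d) d := by
  rw [Finset.sum_sigma', Finset.sum_sigma']
  symm
  refine Finset.sum_bij' (fun x _ => ⟨x.1 * x.2, x.2⟩) (fun x _ => ⟨x.1 / x.2, x.2⟩) ?_ ?_ ?_ ?_ ?_
  · rintro ⟨q, d⟩ h
    simp only [Finset.mem_sigma, Finset.mem_Icc, Nat.mem_divisors] at h ⊢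
    obtain ⟨⟨h1, h2⟩, h3, h4⟩ := h
    have := (Nat.le_div_iff_mul_le (by omega)).1 h4
    have h5 : 0 < q * d := Nat.mul_pos h1 h3
    exact ⟨⟨h5, by rw [mul_comm]; exact this⟩, dvd_mul_left .., h5.ne'⟩
  · rintro ⟨n, d⟩ h
    simp only [Finset.mem_sigma, Finset.mem_Icc, Nat.mem_divisors] at h ⊢
    obtain ⟨⟨h1, h2⟩, ⟨k, rfl⟩, h4⟩ := h
    have hd : 0 < d := Nat.pos_of_ne_zero (by rintro rfl; simp at h4)
    have hk : 0 < k := Nat.pos_of_ne_zero (by rintro rfl; simp at h4)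
    rw [Nat.mul_div_cancel_left _ hd]
    exact ⟨⟨hk, by nlinarith⟩, hd, (Nat.le_div_iff_mul_le hk).2 h2⟩
  · rintro ⟨q, d⟩ h
    simp only [Finset.mem_sigma, Finset.mem_Icc] at h
    simp [Nat.mul_div_cancel _ (show 0 < d by omega)]
  · rintro ⟨n, d⟩ h
    simp only [Finset.mem_sigma, Nat.mem_divisors] at h
    simp [Nat.div_mul_cancel h.2.1]
  · rintro ⟨q, d⟩ h
    rfl

lemma aux_lhs (P : Polynomial ℤ) (Q : ℕ) (g : ℕ → ℕ → ℂ) :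
    ∑ x ∈ fareyPairs P Q, g x.1 x.2 =
      ∑ n ∈ Finset.Icc 1 Q, ∑ a ∈ Finset.Icc 1 n,
        if Int.gcd (P.eval (a : ℤ)) (n : ℤ) = 1 then g a n else 0 := by
  unfold fareyPairs
  rw [Finset.sum_filter, Finset.sum_product_right]
  refine Finset.sum_congr rfl fun n hn => ?_
  have hs : Finset.Icc 1 n = (Finset.Icc 1 Q).filter (fun a => a ≤ n) := by
    ext a
    simp only [Finset.mem_Icc, Finset.mem_filter] at hn ⊢
    omega
  rw [hs, Finset.sum_filter]
  refine Finset.sum_congr rfl fun a _ => ?_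
  simp only [ite_and]

/-- **Lemma (exponential sum over polynomial Farey fractions).**
`Σ_{γ ∈ F_{Q,P}} e(rγ) = Σ_{q ≤ Q, q∣r} q Σ_{d ≤ Q/q} μ(d) Σ_{1 ≤ a ≤ d, P(a) ≡ 0 (d)} e(ra/(qd))`. -/
theorem expSum_polyFarey (ν : ℕ) (hν : 2 ≤ ν) (c : ℕ → ℤ) (hcν : c ν ≠ 0)
    (P : Polynomial ℤ)
    (hP : P = ∑ i ∈ Finset.Icc 1 ν, Polynomial.C (c i) * Polynomial.X ^ i)
    (hdisc : (P.map (Int.castRingHom ℚ)).Separable)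
    (r : ℤ) (Q : ℕ) (hQ : 1 ≤ Q) :
    ∑ x ∈ fareyPairs P Q, eFun ((r : ℝ) * (x.1 : ℝ) / (x.2 : ℝ)) =
      ∑ q ∈ (Finset.Icc 1 Q).filter (fun q : ℕ => (q : ℤ) ∣ r),
        (q : ℂ) * ∑ d ∈ Finset.Icc 1 (Q / q),
          (ArithmeticFunction.moebius d : ℂ) *
            ∑ a ∈ (Finset.Icc 1 d).filter (fun a : ℕ => (d : ℤ) ∣ P.eval (a : ℤ)),
              eFun ((r : ℝ) * (a : ℝ) / ((q : ℝ) * (d : ℝ))) := by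
  rw [aux_lhs P Q (fun a n => eFun ((r : ℝ) * (a : ℝ) / (n : ℝ)))]
  have h1 : ∀ n ∈ Finset.Icc 1 Q, (∑ a ∈ Finset.Icc 1 n,
      if Int.gcd (P.eval (a : ℤ)) (n : ℤ) = 1 then eFun ((r : ℝ) * (a : ℝ) / (n : ℝ)) else 0) =
      ∑ d ∈ n.divisors, (ArithmeticFunction.moebius d : ℂ) *
        ∑ a ∈ (Finset.Icc 1 n).filter (fun a : ℕ => (d : ℤ) ∣ P.eval (a : ℤ)),
          eFun ((r : ℝ) * (a : ℝ) / (n : ℝ)) := by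
    intro n hn
    simp_rw [Finset.sum_filter, Finset.mul_sum]
    rw [Finset.sum_comm]
    refine Finset.sum_congr rfl fun a _ => ?_
    have h := aux_moebius (P.eval (a : ℤ)) n (Finset.mem_Icc.1 hn).1
    rw [← one_mul (eFun ((r : ℝ) * (a : ℝ) / (n : ℝ))), ← zero_mul (eFun ((r : ℝ) * (a : ℝ) / (n : ℝ))), ← ite_mul, ← h,
      Finset.sum_mul]
    refine Finset.sum_congr rfl fun d _ => ?_
    split_ifs <;> simp
  rw [Finset.sum_congr rfl h1, aux_reindex (fun n d => (ArithmeticFunction.moebius d : ℂ) *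
        ∑ a ∈ (Finset.Icc 1 n).filter (fun a : ℕ => (d : ℤ) ∣ P.eval (a : ℤ)),
          eFun ((r : ℝ) * (a : ℝ) / (n : ℝ))), Finset.sum_filter]
  refine Finset.sum_congr rfl fun q hq => ?_
  have h2 : ∀ d ∈ Finset.Icc 1 (Q / q), _ := fun d hd =>
    congrArg (fun z => (ArithmeticFunction.moebius d : ℂ) * z)
      (aux_inner P r q d (Finset.mem_Icc.1 hq).1 (Finset.mem_Icc.1 hd).1)
  rw [Finset.sum_congr rfl h2]
  split_ifs with h
  · rw [Finset.mul_sum]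
    refine Finset.sum_congr rfl fun d _ => ?_
    ring
  · simp
end

section
/- Let ν ≥ 1 and let P(X) = c_ν X^ν + ⋯ + c_1 X ∈ ℤ[X] with c_ν ≥ 1 and c_i ≥ 0 for all 1 ≤ i ≤ ν. Suppose 1 ≤ a ≤ q are integers with gcd(P(a), q) = 1. Then gcd(a, q) = 1, and there is no pair of positive integers (a′, q′) with a′ < a satisfying q′·P(a) = q·P(a′); that is, the lattice point (a, q) is visible from the origin along the curve y = (q/P(a))·P(x), so a/q belongs to the set of F(c)-visible Farey fractions. -/
open Finset

/-- **Lemma (visibility of polynomial Farey points).** For `P(X) = c_ν X^ν + ⋯ + c_1 X`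
with `c_ν ≥ 1` and all `c_i ≥ 0`, if `1 ≤ a ≤ q` and `gcd(P(a), q) = 1`, then
`gcd(a, q) = 1` and there is no pair of positive integers `(a', q')` with `a' < a` and
`q'·P(a) = q·P(a')`; i.e. the lattice point `(a, q)` is `F(c)`-visible. -/
theorem polyFarey_visible (ν : ℕ) (hν : 1 ≤ ν) (c : ℕ → ℕ) (hcν : 1 ≤ c ν)
    (P : Polynomial ℤ)
    (hP : P = ∑ i ∈ Finset.Icc 1 ν, Polynomial.C ((c i : ℤ)) * Polynomial.X ^ i)
    (a q : ℕ) (ha : 1 ≤ a) (haq : a ≤ q)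
    (hgcd : Int.gcd (P.eval (a : ℤ)) (q : ℤ) = 1) :
    Nat.gcd a q = 1 ∧
      ¬∃ (a' q' : ℕ), 0 < a' ∧ 0 < q' ∧ a' < a ∧
        (q' : ℤ) * P.eval (a : ℤ) = (q : ℤ) * P.eval (a' : ℤ) := by
  have hev : ∀ n : ℕ, P.eval (n : ℤ) = ((∑ i ∈ Finset.Icc 1 ν, c i * n ^ i : ℕ) : ℤ) := by
    intro n
    rw [hP, Polynomial.eval_finset_sum]
    simp
  have hmem : ν ∈ Finset.Icc 1 ν := Finset.mem_Icc.mpr ⟨hν, le_refl _⟩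
  rw [hev, Int.gcd_natCast_natCast] at hgcd
  constructor
  · have hd : a ∣ ∑ i ∈ Finset.Icc 1 ν, c i * a ^ i := by
      refine Finset.dvd_sum fun i hi => ?_
      have h1 := (Finset.mem_Icc.mp hi).1
      exact Dvd.dvd.mul_left (dvd_pow_self a (by omega)) _
    exact Nat.Coprime.coprime_dvd_left hd hgcd
  · rintro ⟨a', q', ha', _, hlt, h⟩
    rw [hev, hev] at h
    have h2 : q' * (∑ i ∈ Finset.Icc 1 ν, c i * a ^ i)
        = q * (∑ i ∈ Finset.Icc 1 ν, c i * a' ^ i) := by exact_mod_cast h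
    have hdvd : (∑ i ∈ Finset.Icc 1 ν, c i * a ^ i) ∣ ∑ i ∈ Finset.Icc 1 ν, c i * a' ^ i :=
      Nat.Coprime.dvd_of_dvd_mul_left hgcd (Dvd.intro_left q' h2)
    have hpos : 0 < ∑ i ∈ Finset.Icc 1 ν, c i * a' ^ i :=
      Finset.sum_pos' (fun _ _ => Nat.zero_le _)
        ⟨ν, hmem, Nat.mul_pos hcν (pow_pos ha' ν)⟩
    have hl : ∑ i ∈ Finset.Icc 1 ν, c i * a' ^ i < ∑ i ∈ Finset.Icc 1 ν, c i * a ^ i :=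
      Finset.sum_lt_sum
        (fun i _ => Nat.mul_le_mul_left _ (Nat.pow_le_pow_left hlt.le i))
        ⟨ν, hmem, Nat.mul_lt_mul_of_pos_left (Nat.pow_lt_pow_left hlt (by omega)) hcν⟩
    exact absurd (Nat.le_of_dvd hpos hdvd) (not_le.mpr hl)
end
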